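/- arXiv:2503.04912 — 14 statements merged into one kernel-verified Lean document; each statement's English description precedes it below -/
import Mathlib

section
/- In S, the three ideals I_B + (16λ₁² − 20δ₁λ₁, 4λ₁ − 2δ₁), I_B + (4λ₁ − 2δ₁), and (2γ, γ² + λ₁γ, δ₁² + δ₁γ + 8λ₁² − 12λ₂, 6λ₁δ₁, 12λ₁λ₂, 8λ₁³ − 8λ₁λ₂, 4λ₁ − 2δ₁) all coincide. (This is the equivalence of the presentations of the integral Chow ring of B ∖ π⁻¹(Δ₀₀) in Proposition 4.1.) -/
open MvPolynomial

/-- The ideal `I_B` of relations for `CH*(B)`, in `S = ℤ[γ, δ₁, λ₁, λ₂]` with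
`X 0 = γ`, `X 1 = δ₁`, `X 2 = λ₁`, `X 3 = λ₂`. -/
noncomputable def IB : Ideal (MvPolynomial (Fin 4) ℤ) :=
  Ideal.span {2 * X 0,
    X 0 ^ 2 + X 2 * X 0,
    X 1 ^ 2 + X 1 * X 0 + 8 * X 2 ^ 2 - 12 * X 3,
    24 * X 2 ^ 2 - 48 * X 3,
    2 * X 1 ^ 2 + 2 * X 2 * X 1,
    20 * X 2 * X 3 - 4 * X 1 * X 3,
    8 * X 2 ^ 3 - 8 * X 2 * X 3}

/-- In any ideal containing `4λ₁ - 2δ₁`, the relation `16λ₁² - 20δ₁λ₁` follows from `6λ₁δ₁`. -/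
lemma sixteen_sq_sub_mem {R : Type*} [CommRing R] {I : Ideal R} {d l : R}
    (h : 4 * l - 2 * d ∈ I) (h6 : 6 * l * d ∈ I) : 16 * l ^ 2 - 20 * d * l ∈ I := by
  have key : 16 * l ^ 2 - 20 * d * l = 4 * l * (4 * l - 2 * d) - 2 * (6 * l * d) := by ring
  rw [key]
  exact I.sub_mem (I.mul_mem_left _ h) (I.mul_mem_left _ h6)

/-- Modulo `4λ₁ - 2δ₁`, the relations `2δ₁² + 2λ₁δ₁` and `6λ₁δ₁` are equivalent. -/
lemma two_sq_add_mem_iff {R : Type*} [CommRing R] {I : Ideal R} {d l : R}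
    (h : 4 * l - 2 * d ∈ I) : 2 * d ^ 2 + 2 * l * d ∈ I ↔ 6 * l * d ∈ I := by
  have key : 6 * l * d = 2 * d ^ 2 + 2 * l * d + d * (4 * l - 2 * d) := by ring
  rw [key]
  exact (I.add_mem_iff_left (I.mul_mem_left _ h)).symm

/-- Modulo `4λ₁ - 2δ₁`, the relations `20λ₁λ₂ - 4δ₁λ₂` and `12λ₁λ₂` are equivalent. -/
lemma twenty_mul_sub_mem_iff {R : Type*} [CommRing R] {I : Ideal R} {d l m : R}
    (h : 4 * l - 2 * d ∈ I) : 20 * l * m - 4 * d * m ∈ I ↔ 12 * l * m ∈ I := by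
  have key : 20 * l * m - 4 * d * m = 12 * l * m + 2 * m * (4 * l - 2 * d) := by ring
  rw [key]
  exact I.add_mem_iff_left (I.mul_mem_left _ h)

/-- The relation `24λ₁² - 48λ₂` is redundant once `6λ₁δ₁` and `4λ₁ - 2δ₁` are imposed. -/
lemma twentyFour_sq_sub_mem {R : Type*} [CommRing R] {I : Ideal R} {g d l m : R}
    (hg : 2 * g ∈ I) (hq : d ^ 2 + d * g + 8 * l ^ 2 - 12 * m ∈ I)
    (h : 4 * l - 2 * d ∈ I) (h6 : 6 * l * d ∈ I) : 24 * l ^ 2 - 48 * m ∈ I := by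
  have key : 24 * l ^ 2 - 48 * m = 4 * (d ^ 2 + d * g + 8 * l ^ 2 - 12 * m)
      + (2 * d - 2 * l) * (4 * l - 2 * d) - 2 * d * (2 * g) - 2 * (6 * l * d) := by ring
  rw [key]
  exact I.sub_mem (I.sub_mem (I.add_mem (I.mul_mem_left _ hq) (I.mul_mem_left _ h))
    (I.mul_mem_left _ hg)) (I.mul_mem_left _ h6)

/-- Equivalence of the presentations of `CH*(B ∖ π⁻¹(Δ₀₀))` in Proposition 4.1. -/
theorem stmt_3 :
    (IB ⊔ Ideal.span ({16 * X 2 ^ 2 - 20 * X 1 * X 2,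
        4 * X 2 - 2 * X 1} : Set (MvPolynomial (Fin 4) ℤ)) =
      IB ⊔ Ideal.span ({4 * X 2 - 2 * X 1} : Set (MvPolynomial (Fin 4) ℤ)))
    ∧
    (IB ⊔ Ideal.span ({4 * X 2 - 2 * X 1} : Set (MvPolynomial (Fin 4) ℤ)) =
      Ideal.span ({2 * X 0,
        X 0 ^ 2 + X 2 * X 0,
        X 1 ^ 2 + X 1 * X 0 + 8 * X 2 ^ 2 - 12 * X 3,
        6 * X 2 * X 1,
        12 * X 2 * X 3,
        8 * X 2 ^ 3 - 8 * X 2 * X 3,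
        4 * X 2 - 2 * X 1} : Set (MvPolynomial (Fin 4) ℤ))) := by
  have hJ {p : MvPolynomial (Fin 4) ℤ} (hp : p ∈ IB) :
      p ∈ IB ⊔ Ideal.span ({4 * X 2 - 2 * X 1} : Set (MvPolynomial (Fin 4) ℤ)) :=
    Ideal.mem_sup_left hp
  have h : 4 * X 2 - 2 * X 1 ∈
      IB ⊔ Ideal.span ({4 * X 2 - 2 * X 1} : Set (MvPolynomial (Fin 4) ℤ)) :=
    Ideal.mem_sup_right (Ideal.mem_span_singleton_self _)
  have h6 : 6 * X 2 * X 1 ∈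
      IB ⊔ Ideal.span ({4 * X 2 - 2 * X 1} : Set (MvPolynomial (Fin 4) ℤ)) :=
    (two_sq_add_mem_iff h).1 (hJ (Ideal.subset_span (by simp)))
  refine ⟨le_antisymm (sup_le le_sup_left ?_) (sup_le_sup_left (Ideal.span_mono (by simp)) _),
    le_antisymm (sup_le ?_ (Ideal.span_mono (by simp))) ?_⟩
  · rw [Ideal.span_le]
    rintro p (rfl | rfl)
    · exact sixteen_sq_sub_mem h h6
    · exact h
  · rw [IB, Ideal.span_le]
    rintro p (rfl | rfl | rfl | rfl | rfl | rfl | rfl)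
    · exact Ideal.subset_span (by simp)
    · exact Ideal.subset_span (by simp)
    · exact Ideal.subset_span (by simp)
    · exact twentyFour_sq_sub_mem (g := X 0) (d := X 1) (Ideal.subset_span (by simp))
        (Ideal.subset_span (by simp)) (Ideal.subset_span (by simp)) (Ideal.subset_span (by simp))
    · exact (two_sq_add_mem_iff (Ideal.subset_span (by simp))).2 (Ideal.subset_span (by simp))
    · exact (twenty_mul_sub_mem_iff (Ideal.subset_span (by simp))).2 (Ideal.subset_span (by simp))
    · exact Ideal.subset_span (by simp)
  · rw [Ideal.span_le]
    rintro p (rfl | rfl | rfl | rfl | rfl | rfl | rfl)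
    · exact hJ (Ideal.subset_span (by simp))
    · exact hJ (Ideal.subset_span (by simp))
    · exact hJ (Ideal.subset_span (by simp))
    · exact h6
    · exact (twenty_mul_sub_mem_iff h).1 (hJ (Ideal.subset_span (by simp)))
    · exact hJ (Ideal.subset_span (by simp))
    · exact h
end

section
/- In S, the ideal I_B + (4λ₁ − 2δ₁, 6λ₁, δ₁² + δ₁λ₁) equals the ideal (2γ, γ² + λ₁γ, δ₁² + δ₁γ + 2λ₁² − 12λ₂, 2λ₁³ − 2λ₁λ₂, 4λ₁ − 2δ₁, 6λ₁, δ₁² + δ₁λ₁). (This is the equivalence of the presentations of the integral Chow ring of B ∖ π⁻¹(Δ₀) in Proposition 4.1.) -/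
open MvPolynomial

/-- Equivalence of the presentations of `CH*(B ∖ π⁻¹(Δ₀))` in Proposition 4.1. -/
theorem stmt_4 :
    IB ⊔ Ideal.span ({4 * X 2 - 2 * X 1,
        6 * X 2,
        X 1 ^ 2 + X 1 * X 2} : Set (MvPolynomial (Fin 4) ℤ)) =
    Ideal.span ({2 * X 0,
        X 0 ^ 2 + X 2 * X 0,
        X 1 ^ 2 + X 1 * X 0 + 2 * X 2 ^ 2 - 12 * X 3,
        2 * X 2 ^ 3 - 2 * X 2 * X 3,
        4 * X 2 - 2 * X 1,
        6 * X 2,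
        X 1 ^ 2 + X 1 * X 2} : Set (MvPolynomial (Fin 4) ℤ)) := by
  rw [IB, ← Ideal.span_union]
  apply le_antisymm <;> rw [Ideal.span_le]
  · set J := Ideal.span ({2 * X 0,
        X 0 ^ 2 + X 2 * X 0,
        X 1 ^ 2 + X 1 * X 0 + 2 * X 2 ^ 2 - 12 * X 3,
        2 * X 2 ^ 3 - 2 * X 2 * X 3,
        4 * X 2 - 2 * X 1,
        6 * X 2,
        X 1 ^ 2 + X 1 * X 2} : Set (MvPolynomial (Fin 4) ℤ))
    have h₁ : 2 * X 0 ∈ J := Ideal.subset_span (by simp)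
    have h₂ : X 0 ^ 2 + X 2 * X 0 ∈ J := Ideal.subset_span (by simp)
    have h₃ : X 1 ^ 2 + X 1 * X 0 + 2 * X 2 ^ 2 - 12 * X 3 ∈ J := Ideal.subset_span (by simp)
    have h₄ : 2 * X 2 ^ 3 - 2 * X 2 * X 3 ∈ J := Ideal.subset_span (by simp)
    have h₅ : 4 * X 2 - 2 * X 1 ∈ J := Ideal.subset_span (by simp)
    have h₆ : 6 * X 2 ∈ J := Ideal.subset_span (by simp)
    have h₇ : X 1 ^ 2 + X 1 * X 2 ∈ J := Ideal.subset_span (by simp)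
    rintro p ((rfl | rfl | rfl | rfl | rfl | rfl | rfl) | (rfl | rfl | rfl)) <;>
      rw [SetLike.mem_coe]
    · exact h₁
    · exact h₂
    · convert J.add_mem h₃ (J.mul_mem_left (X 2) h₆) using 1
      ring
    · convert J.add_mem (J.sub_mem (J.mul_mem_left 4 h₃) (J.mul_mem_left (2 * X 1) h₁))
        (J.mul_mem_left (4 * X 2 + 2 * X 1) h₅) using 1
      ring
    · convert J.mul_mem_left 2 h₇ using 1
      ring
    · convert J.add_mem (J.mul_mem_left (2 * X 3) h₅) (J.mul_mem_left (2 * X 3) h₆) using 1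
      ring
    · convert J.mul_mem_left 4 h₄ using 1
      ring
    · exact h₅
    · exact h₆
    · exact h₇
  · rintro p (rfl | rfl | rfl | rfl | rfl | rfl | rfl) <;> rw [SetLike.mem_coe]
    · exact Ideal.subset_span (by simp)
    · exact Ideal.subset_span (by simp)
    · have h : X 1 ^ 2 + X 1 * X 0 + 2 * X 2 ^ 2 - 12 * X 3 =
          (X 1 ^ 2 + X 1 * X 0 + 8 * X 2 ^ 2 - 12 * X 3) -
            X 2 * (6 * X 2 : MvPolynomial (Fin 4) ℤ) := by ring
      rw [h]
      exact Ideal.sub_mem _ (Ideal.subset_span (by simp))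
        (Ideal.mul_mem_left _ _ (Ideal.subset_span (by simp)))
    · have h : 2 * X 2 ^ 3 - 2 * X 2 * X 3 =
          (8 * X 2 ^ 3 - 8 * X 2 * X 3) -
            (X 2 ^ 2 - X 3) * (6 * X 2 : MvPolynomial (Fin 4) ℤ) := by ring
      rw [h]
      exact Ideal.sub_mem _ (Ideal.subset_span (by simp))
        (Ideal.mul_mem_left _ _ (Ideal.subset_span (by simp)))
    · exact Ideal.subset_span (by simp)
    · exact Ideal.subset_span (by simp)
    · exact Ideal.subset_span (by simp)
end

section
/- In R, the ideal (2(δ₁ + λ₁), δ₁(δ₁ + λ₁), 24λ₁² − 48λ₂, 24λ₁λ₂) equals the ideal J + (2(δ₁ + λ₁), δ₁(δ₁ + λ₁)). (This expresses the paper's computation, in §5.1, that the kernel of the restriction map CH*(M̄₂) → CH*(Δ₁) is generated by 2(δ₁ + λ₁) and δ₁(δ₁ + λ₁).) -/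
open MvPolynomial

/-- The ideal `J` of relations for `CH*(M̄₂)`, in `R = ℤ[λ₁, λ₂, δ₁]` with
`X 0 = λ₁`, `X 1 = λ₂`, `X 2 = δ₁`. -/
noncomputable def Jm2 : Ideal (MvPolynomial (Fin 3) ℤ) :=
  Ideal.span {24 * X 0 ^ 2 - 48 * X 1,
    20 * X 0 * X 1 - 4 * X 2 * X 1,
    X 2 ^ 3 + X 2 ^ 2 * X 0,
    2 * X 2 ^ 2 + 2 * X 2 * X 0}

/-- The kernel of `CH*(M̄₂) → CH*(Δ₁)` is generated by `2(δ₁+λ₁)` and `δ₁(δ₁+λ₁)` (§5.1). -/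
theorem stmt_5 :
    Ideal.span ({2 * (X 2 + X 0),
        X 2 * (X 2 + X 0),
        24 * X 0 ^ 2 - 48 * X 1,
        24 * X 0 * X 1} : Set (MvPolynomial (Fin 3) ℤ)) =
    Jm2 ⊔ Ideal.span ({2 * (X 2 + X 0),
        X 2 * (X 2 + X 0)} : Set (MvPolynomial (Fin 3) ℤ)) := by
  apply le_antisymm
  · have hs : ∀ p ∈ ({2 * (X 2 + X 0), X 2 * (X 2 + X 0)} : Set (MvPolynomial (Fin 3) ℤ)),
        p ∈ Jm2 ⊔ Ideal.span ({2 * (X 2 + X 0),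
          X 2 * (X 2 + X 0)} : Set (MvPolynomial (Fin 3) ℤ)) :=
      fun p hp => Ideal.mem_sup_right (Ideal.subset_span hp)
    rw [Ideal.span_le]
    rintro p (rfl | rfl | rfl | rfl)
    · exact hs _ (by simp)
    · exact hs _ (by simp)
    · exact Ideal.mem_sup_left (Ideal.subset_span (by simp))
    · have h : (24 * X 0 * X 1 : MvPolynomial (Fin 3) ℤ) =
          (20 * X 0 * X 1 - 4 * X 2 * X 1) + 2 * X 1 * (2 * (X 2 + X 0)) := by ring
      rw [h]
      exact add_mem (Ideal.mem_sup_left (Ideal.subset_span (by simp)))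
        (Ideal.mul_mem_left _ _ (hs _ (by simp)))
  · refine sup_le ?_ (Ideal.span_mono (by
      rintro p (rfl | rfl) <;> simp))
    rw [Jm2, Ideal.span_le]
    rintro p (rfl | rfl | rfl | rfl)
    · exact Ideal.subset_span (by simp)
    · have h : (20 * X 0 * X 1 - 4 * X 2 * X 1 : MvPolynomial (Fin 3) ℤ) =
          24 * X 0 * X 1 - 2 * X 1 * (2 * (X 2 + X 0)) := by ring
      rw [h]
      exact sub_mem (Ideal.subset_span (by simp))
        (Ideal.mul_mem_left _ _ (Ideal.subset_span (by simp)))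
    · have h : (X 2 ^ 3 + X 2 ^ 2 * X 0 : MvPolynomial (Fin 3) ℤ) =
          X 2 * (X 2 * (X 2 + X 0)) := by ring
      rw [h]
      exact Ideal.mul_mem_left _ _ (Ideal.subset_span (by simp))
    · have h : (2 * X 2 ^ 2 + 2 * X 2 * X 0 : MvPolynomial (Fin 3) ℤ) =
          2 * (X 2 * (X 2 + X 0)) := by ring
      rw [h]
      exact Ideal.mul_mem_left _ _ (Ideal.subset_span (by simp))
end

section
/- In R, the intersection of the three ideals J + (2(δ₁ + λ₁), δ₁(δ₁ + λ₁)), J + (48λ₂, 24λ₂ + 6δ₁², 24λ₂δ₁, 4λ₁λ₂ + 4λ₂δ₁, 8λ₁² − 24λ₂ − 2δ₁², 16λ₂δ₁ + 2δ₁³), and J + (δ₁) equals the ideal J + (24λ₂δ₁). (This is the ideal-intersection computation of §5.1 used to determine the classes β₃ᵢ.) -/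
open MvPolynomial

/-- Setting a variable to zero does not change a polynomial modulo that variable. -/
theorem MvPolynomial.X_dvd_sub_aeval_update_zero {σ R : Type*} [CommRing R] [DecidableEq σ]
    (i : σ) (p : MvPolynomial σ R) :
    X i ∣ p - aeval (Function.update X i (0 : MvPolynomial σ R)) p := by
  rw [← Ideal.mem_span_singleton, ← Ideal.Quotient.mk_eq_mk_iff_sub_mem]
  have h : Ideal.Quotient.mkₐ R (Ideal.span {(X i : MvPolynomial σ R)}) =
      (Ideal.Quotient.mkₐ R (Ideal.span {(X i : MvPolynomial σ R)})).comp
        (aeval (Function.update X i (0 : MvPolynomial σ R))) := by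
    ext j
    by_cases hj : j = i
    · subst hj
      simp
    · simp [hj]
  exact DFunLike.congr_fun h p

/-- If `λ₁` times `2p` is a relation after setting `δ₁ = 0`, then `p` is, up to a multiple of
`δ₁`, a combination of the relations divided by `2` and by `2λ₁`. -/
theorem exists_eq_of_two_mul_X_mul_mem {p : MvPolynomial (Fin 3) ℤ}
    (hp : 2 * X 0 * aeval (Function.update X 2 (0 : MvPolynomial (Fin 3) ℤ)) p ∈
      Ideal.span ({24 * X 0 ^ 2 - 48 * X 1, 20 * X 0 * X 1} : Set (MvPolynomial (Fin 3) ℤ))) :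
    ∃ r s t, p = r * (12 * X 0 ^ 2 - 24 * X 1) + s * (10 * X 1) + X 2 * t := by
  obtain ⟨r, s, h⟩ := Ideal.mem_span_pair.1 hp
  obtain ⟨t, ht⟩ := X_dvd_sub_aeval_update_zero 2 p
  set p₀ := aeval (Function.update X 2 (0 : MvPolynomial (Fin 3) ℤ)) p
  have hprime : Prime (X 0 : MvPolynomial (Fin 3) ℤ) := X_prime
  have hdvd : (X 0 : MvPolynomial (Fin 3) ℤ) ∣ 48 * X 1 * r :=
    ⟨24 * X 0 * r + 20 * X 1 * s - 2 * p₀, by linear_combination -h⟩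
  rcases hprime.dvd_or_dvd hdvd with h48 | ⟨r', rfl⟩
  · have := map_dvd (eval ![(0 : ℤ), 1, 1]) h48
    simp at this
  · refine ⟨r', s, t, ?_⟩
    have h2 : (2 * X 0 : MvPolynomial (Fin 3) ℤ) ≠ 0 :=
      mul_ne_zero two_ne_zero hprime.ne_zero
    have h₀ : p₀ = r' * (12 * X 0 ^ 2 - 24 * X 1) + s * (10 * X 1) :=
      mul_left_cancel₀ h2 (by linear_combination -h)
    linear_combination ht + h₀

/-- Over a domain of characteristic two, cancelling `δ₁(δ₁ + λ₁)` from a multiple of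
`δ₁²(δ₁ + λ₁)` leaves a multiple of `δ₁`; this is the resulting statement over `ℤ`. -/
theorem exists_eq_of_map_mem_span {q : MvPolynomial (Fin 3) ℤ}
    (hq : map (Int.castRingHom (ZMod 2)) (X 2 * (X 2 + X 0) * q) ∈
      Ideal.span {(X 2 ^ 2 * (X 2 + X 0) : MvPolynomial (Fin 3) (ZMod 2))}) :
    ∃ t u, q = X 2 * t + 2 * u := by
  obtain ⟨t', ht'⟩ := Ideal.mem_span_singleton.1 hq
  obtain ⟨t, rfl⟩ := map_surjective (Int.castRingHom (ZMod 2)) (ZMod.intCast_surjective) t'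
  have hne : (X 2 * (X 2 + X 0) : MvPolynomial (Fin 3) (ZMod 2)) ≠ 0 := by
    intro h
    have := congrArg (eval ![(0 : ZMod 2), 0, 1]) h
    simp at this
  have hmap : map (Int.castRingHom (ZMod 2)) q = X 2 * map (Int.castRingHom (ZMod 2)) t := by
    apply mul_left_cancel₀ hne
    simp only [map_mul, map_add, map_X] at ht'
    linear_combination ht'
  obtain ⟨u, hu⟩ := (C_dvd_iff_zmod 2 (q - X 2 * t)).2 (by simp [hmap])
  refine ⟨t, u, ?_⟩
  have hC : (C ((2 : ℕ) : ℤ) : MvPolynomial (Fin 3) ℤ) = 2 := by simp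
  rw [hC] at hu
  linear_combination hu

/-- The ideal-intersection computation of §5.1 used to determine the `β₃ᵢ`. -/
theorem stmt_6 :
    (Jm2 ⊔ Ideal.span ({2 * (X 2 + X 0),
        X 2 * (X 2 + X 0)} : Set (MvPolynomial (Fin 3) ℤ)))
    ⊓ (Jm2 ⊔ Ideal.span ({48 * X 1,
        24 * X 1 + 6 * X 2 ^ 2,
        24 * X 1 * X 2,
        4 * X 0 * X 1 + 4 * X 1 * X 2,
        8 * X 0 ^ 2 - 24 * X 1 - 2 * X 2 ^ 2,
        16 * X 1 * X 2 + 2 * X 2 ^ 3} : Set (MvPolynomial (Fin 3) ℤ)))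
    ⊓ (Jm2 ⊔ Ideal.span ({X 2} : Set (MvPolynomial (Fin 3) ℤ))) =
    Jm2 ⊔ Ideal.span ({24 * X 1 * X 2} : Set (MvPolynomial (Fin 3) ℤ)) := by
  have hJ : ∀ x ∈ ({24 * X 0 ^ 2 - 48 * X 1, 20 * X 0 * X 1 - 4 * X 2 * X 1,
      X 2 ^ 3 + X 2 ^ 2 * X 0, 2 * X 2 ^ 2 + 2 * X 2 * X 0} : Set (MvPolynomial (Fin 3) ℤ)),
      x ∈ Jm2 := fun x hx => Ideal.subset_span hx
  simp only [Set.mem_insert_iff, Set.mem_singleton_iff, forall_eq_or_imp, forall_eq] at hJ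
  obtain ⟨hJ₁, hJ₂, hJ₃, hJ₄⟩ := hJ
  apply le_antisymm
  · set K := Jm2 ⊔ Ideal.span ({24 * X 1 * X 2} : Set (MvPolynomial (Fin 3) ℤ))
    have hJK : Jm2 ≤ K := le_sup_left
    have hbd : 24 * X 1 * X 2 ∈ K :=
      Ideal.mem_sup_right (Ideal.mem_span_singleton_self _)
    have h3 : Jm2 ⊔ Ideal.span ({X 2} : Set (MvPolynomial (Fin 3) ℤ)) ≤
        (Ideal.span ({24 * X 0 ^ 2 - 48 * X 1, 20 * X 0 * X 1} :
          Set (MvPolynomial (Fin 3) ℤ))).comap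
          (aeval (Function.update X 2 (0 : MvPolynomial (Fin 3) ℤ))) := by
      refine sup_le (Ideal.span_le.2 ?_) (Ideal.span_le.2 ?_)
      · rintro _ (rfl | rfl | rfl | rfl) <;>
          simp only [SetLike.mem_coe, Ideal.mem_comap, Ideal.mem_span_pair, map_add, map_sub,
            map_mul, map_pow, aeval_X, map_ofNat, Function.update_self, Function.update_of_ne, ne_eq,
            Fin.reduceEq, not_false_eq_true]
        · exact ⟨1, 0, by ring⟩
        · exact ⟨0, 1, by ring⟩
        · exact ⟨0, 0, by ring⟩
        · exact ⟨0, 0, by ring⟩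
      · rintro _ rfl
        simp
    have h2 : Jm2 ⊔ Ideal.span ({48 * X 1, 24 * X 1 + 6 * X 2 ^ 2, 24 * X 1 * X 2,
        4 * X 0 * X 1 + 4 * X 1 * X 2, 8 * X 0 ^ 2 - 24 * X 1 - 2 * X 2 ^ 2,
        16 * X 1 * X 2 + 2 * X 2 ^ 3} : Set (MvPolynomial (Fin 3) ℤ)) ≤
        (Ideal.span {(X 2 ^ 2 * (X 2 + X 0) : MvPolynomial (Fin 3) (ZMod 2))}).comap
          (map (Int.castRingHom (ZMod 2))) := by
      have h0 : (2 : MvPolynomial (Fin 3) (ZMod 2)) = 0 := CharTwo.two_eq_zero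
      refine sup_le (Ideal.span_le.2 ?_) (Ideal.span_le.2 ?_)
      · rintro _ (rfl | rfl | rfl | rfl) <;>
          simp only [SetLike.mem_coe, Ideal.mem_comap, Ideal.mem_span_singleton, map_add, map_sub,
            map_mul, map_pow, map_X, map_ofNat]
        · exact ⟨0, by linear_combination (12 * X 0 ^ 2 - 24 * X 1) * h0⟩
        · exact ⟨0, by linear_combination (10 * X 0 * X 1 - 2 * X 2 * X 1) * h0⟩
        · exact ⟨1, by ring⟩
        · exact ⟨0, by linear_combination (X 2 ^ 2 + X 2 * X 0) * h0⟩
      · rintro _ (rfl | rfl | rfl | rfl | rfl | rfl) <;>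
          simp only [SetLike.mem_coe, Ideal.mem_comap, Ideal.mem_span_singleton, map_add, map_sub,
            map_mul, map_pow, map_X, map_ofNat]
        · exact ⟨0, by linear_combination 24 * X 1 * h0⟩
        · exact ⟨0, by linear_combination (12 * X 1 + 3 * X 2 ^ 2) * h0⟩
        · exact ⟨0, by linear_combination 12 * X 1 * X 2 * h0⟩
        · exact ⟨0, by linear_combination (2 * X 0 * X 1 + 2 * X 1 * X 2) * h0⟩
        · exact ⟨0, by linear_combination (4 * X 0 ^ 2 - 12 * X 1 - X 2 ^ 2) * h0⟩
        · exact ⟨0, by linear_combination (8 * X 1 * X 2 + X 2 ^ 3) * h0⟩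
    rintro f ⟨⟨hf1, hf2⟩, hf3⟩
    obtain ⟨j, hj, g, hg, rfl⟩ := Submodule.mem_sup.1 hf1
    obtain ⟨p, q, rfl⟩ := Ideal.mem_span_pair.1 hg
    have hp := h3 (((Submodule.add_mem_iff_right _ (Ideal.mem_sup_left hj)).1 hf3))
    obtain ⟨r, s, t, rfl⟩ := exists_eq_of_two_mul_X_mul_mem (p := p) (by
      rw [Ideal.mem_comap] at hp
      simp only [map_add, map_mul, aeval_X, map_ofNat, Function.update_self, Function.update_of_ne,
        ne_eq, Fin.reduceEq, not_false_eq_true] at hp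
      convert hp using 1
      ring)
    have hpK : (r * (12 * X 0 ^ 2 - 24 * X 1) + s * (10 * X 1) + X 2 * t) * (2 * (X 2 + X 0)) ∈
        K := by
      have := K.add_mem (K.add_mem (K.mul_mem_left (r * (X 2 + X 0)) (hJK hJ₁))
        (K.mul_mem_left s (K.add_mem (hJK hJ₂) hbd))) (K.mul_mem_left t (hJK hJ₄))
      convert this using 1
      ring
    have hKI : K ≤ Jm2 ⊔ Ideal.span ({48 * X 1, 24 * X 1 + 6 * X 2 ^ 2, 24 * X 1 * X 2,
        4 * X 0 * X 1 + 4 * X 1 * X 2, 8 * X 0 ^ 2 - 24 * X 1 - 2 * X 2 ^ 2,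
        16 * X 1 * X 2 + 2 * X 2 ^ 3} : Set (MvPolynomial (Fin 3) ℤ)) :=
      sup_le_sup_left (Ideal.span_mono (by simp)) _
    have hq := (Submodule.add_mem_iff_right _ (hKI hpK)).1
      ((Submodule.add_mem_iff_right _ (Ideal.mem_sup_left hj)).1 hf2)
    rw [mul_comm q] at hq
    obtain ⟨v, u, rfl⟩ := exists_eq_of_map_mem_span (h2 hq)
    refine K.add_mem (hJK hj) (K.add_mem hpK (hJK ?_))
    convert Jm2.add_mem (Jm2.mul_mem_left v hJ₃) (Jm2.mul_mem_left u hJ₄) using 1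
    ring
  · refine sup_le (le_inf (le_inf le_sup_left le_sup_left) le_sup_left) ?_
    rw [Ideal.span_singleton_le_iff_mem]
    refine Ideal.mem_inf.2 ⟨Ideal.mem_inf.2 ⟨?_, ?_⟩, ?_⟩
    · have h : (2 * (X 2 + X 0) : MvPolynomial (Fin 3) ℤ) ∈ Jm2 ⊔ Ideal.span
          ({2 * (X 2 + X 0), X 2 * (X 2 + X 0)} : Set (MvPolynomial (Fin 3) ℤ)) :=
        Ideal.mem_sup_right (Ideal.subset_span (by simp))
      convert Ideal.sub_mem _ (Ideal.mul_mem_left _ (10 * X 1) h) (Ideal.mem_sup_left hJ₂) using 1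
      ring
    · exact Ideal.mem_sup_right (Ideal.subset_span (by simp))
    · exact Ideal.mem_sup_right (Ideal.mul_mem_left _ _ (Ideal.mem_span_singleton_self _))
end

section
/- In R, graded as indicated: every homogeneous element of weighted degree 4, and every homogeneous element of weighted degree 6, of the ideal J + (24λ₂δ₁) lies in J; and every homogeneous element of weighted degree 5 of J + (24λ₂δ₁) is congruent modulo J to n·(24λ₂²δ₁) for some integer n. (This is the graded analysis of §5.1 showing β₃₁ = β₃₃ = 0 and β₃₂ = 24y·λ₂²δ₁.) -/
open MvPolynomial

/-- The codimension grading: `λ₁` and `δ₁` have weight 1, `λ₂` has weight 2. -/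
def wt : Fin 3 → ℕ := ![1, 2, 1]

section

attribute [local instance] weightedGradedAlgebra

theorem isHomogeneous_Jm2 : Jm2.IsHomogeneous (weightedHomogeneousSubmodule ℤ wt) := by
  have h0 : IsWeightedHomogeneous wt (X 0 : MvPolynomial (Fin 3) ℤ) 1 :=
    isWeightedHomogeneous_X ℤ wt 0
  have h1 : IsWeightedHomogeneous wt (X 1 : MvPolynomial (Fin 3) ℤ) 2 :=
    isWeightedHomogeneous_X ℤ wt 1
  have h2 : IsWeightedHomogeneous wt (X 2 : MvPolynomial (Fin 3) ℤ) 1 :=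
    isWeightedHomogeneous_X ℤ wt 2
  have hc (n : ℤ) : IsWeightedHomogeneous wt (C n : MvPolynomial (Fin 3) ℤ) 0 :=
    isWeightedHomogeneous_C wt n
  apply Ideal.homogeneous_span
  rintro x (rfl | rfl | rfl | rfl)
  · exact ⟨2, sub_mem ((hc 24).mul (h0.pow 2)) ((hc 48).mul h1)⟩
  · exact ⟨3, sub_mem (((hc 20).mul h0).mul h1) (((hc 4).mul h2).mul h1)⟩
  · exact ⟨3, add_mem (h2.pow 3) ((h2.pow 2).mul h0)⟩
  · exact ⟨2, add_mem ((hc 2).mul (h2.pow 2)) (((hc 2).mul h2).mul h0)⟩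

theorem weightedHomogeneousComponent_mem_Jm2 {p : MvPolynomial (Fin 3) ℤ} (hp : p ∈ Jm2) (n : ℕ) :
    weightedHomogeneousComponent wt n p ∈ Jm2 :=
  weightedHomogeneousComponent_mem_of_mem ℤ wt isHomogeneous_Jm2 hp n

end

theorem X_zero_mul_mem_Jm2 : (X 0 * (24 * X 1 * X 2) : MvPolynomial (Fin 3) ℤ) ∈ Jm2 := by
  have h1 : (20 * X 0 * X 1 - 4 * X 2 * X 1 : MvPolynomial (Fin 3) ℤ) ∈ Jm2 :=
    Ideal.subset_span (by simp)
  have h2 : (2 * X 2 ^ 2 + 2 * X 2 * X 0 : MvPolynomial (Fin 3) ℤ) ∈ Jm2 :=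
    Ideal.subset_span (by simp)
  convert add_mem (Jm2.mul_mem_left (X 2) h1) (Jm2.mul_mem_left (2 * X 1) h2) using 1
  ring

theorem X_two_mul_mem_Jm2 : (X 2 * (24 * X 1 * X 2) : MvPolynomial (Fin 3) ℤ) ∈ Jm2 := by
  have h2 : (2 * X 2 ^ 2 + 2 * X 2 * X 0 : MvPolynomial (Fin 3) ℤ) ∈ Jm2 :=
    Ideal.subset_span (by simp)
  convert sub_mem (Jm2.mul_mem_left (12 * X 1) h2) X_zero_mul_mem_Jm2 using 1
  ring

/-- Modulo `Jm2`, multiples of `24λ₂δ₁` only depend on the cofactor modulo `λ₁` and `δ₁`. -/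
theorem exists_polynomial_sub_mem_Jm2 (q : MvPolynomial (Fin 3) ℤ) :
    ∃ f : Polynomial ℤ, (q - Polynomial.aeval (X 1) f) * (24 * X 1 * X 2) ∈ Jm2 := by
  induction q using MvPolynomial.induction_on with
  | C a => exact ⟨Polynomial.C a, by simp⟩
  | add p q hp hq =>
    obtain ⟨f, hf⟩ := hp
    obtain ⟨g, hg⟩ := hq
    refine ⟨f + g, ?_⟩
    convert add_mem hf hg using 1
    rw [map_add]
    ring
  | mul_X p i hp =>
    obtain ⟨f, hf⟩ := hp
    fin_cases i
    · refine ⟨0, ?_⟩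
      convert Jm2.mul_mem_left p X_zero_mul_mem_Jm2 using 1
      simp [mul_assoc]
    · refine ⟨f * Polynomial.X, ?_⟩
      convert Jm2.mul_mem_left (X 1) hf using 1
      simp only [map_mul, Polynomial.aeval_X, Fin.mk_one]
      ring
    · refine ⟨0, ?_⟩
      convert Jm2.mul_mem_left p X_two_mul_mem_Jm2 using 1
      simp [mul_assoc]

theorem weightedHomogeneousComponent_aeval_X_one_mul (f : Polynomial ℤ) (n : ℕ) :
    weightedHomogeneousComponent wt n
      (Polynomial.aeval (X 1 : MvPolynomial (Fin 3) ℤ) f * (24 * X 1 * X 2)) =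
    ∑ k ∈ f.support,
      if n = 2 * k + 3 then C (f.coeff k) * X 1 ^ k * (24 * X 1 * X 2) else 0 := by
  rw [Polynomial.aeval_def, Polynomial.eval₂_eq_sum, Polynomial.sum_def, Finset.sum_mul, map_sum]
  refine Finset.sum_congr rfl fun k _ => ?_
  have h : IsWeightedHomogeneous wt
      (C (f.coeff k) * X 1 ^ k * (24 * X 1 * X 2) : MvPolynomial (Fin 3) ℤ) (2 * k + 3) := by
    have h24 : IsWeightedHomogeneous wt (24 : MvPolynomial (Fin 3) ℤ) 0 :=
      isWeightedHomogeneous_C wt (24 : ℤ)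
    convert ((isWeightedHomogeneous_C wt (f.coeff k)).mul
      ((isWeightedHomogeneous_X ℤ wt 1).pow k)).mul
      ((h24.mul (isWeightedHomogeneous_X ℤ wt 1)).mul (isWeightedHomogeneous_X ℤ wt 2)) using 1
    simp [wt]
    ring
  rw [algebraMap_eq]
  split_ifs with hn
  · rw [hn, h.weightedHomogeneousComponent_same]
  · exact h.weightedHomogeneousComponent_ne _ hn

/-- A homogeneous element of `J + (24λ₂δ₁)` is, modulo `J`, a combination of those `24λ₂ᵏ⁺¹δ₁`
that have the same degree. -/
theorem exists_polynomial_of_mem_sup {p : MvPolynomial (Fin 3) ℤ} {n : ℕ}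
    (hp : p ∈ Jm2 ⊔ Ideal.span {24 * X 1 * X 2}) (hn : IsWeightedHomogeneous wt p n) :
    ∃ f : Polynomial ℤ, p - ∑ k ∈ f.support,
      (if n = 2 * k + 3 then C (f.coeff k) * X 1 ^ k * (24 * X 1 * X 2) else 0) ∈ Jm2 := by
  obtain ⟨j, hj, r, hr, rfl⟩ := Submodule.mem_sup.mp hp
  obtain ⟨q, rfl⟩ := Ideal.mem_span_singleton'.mp hr
  obtain ⟨f, hf⟩ := exists_polynomial_sub_mem_Jm2 q
  refine ⟨f, ?_⟩
  have h := weightedHomogeneousComponent_mem_Jm2 (add_mem hj hf) n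
  rwa [sub_mul, ← add_sub_assoc, map_sub, hn.weightedHomogeneousComponent_same,
    weightedHomogeneousComponent_aeval_X_one_mul] at h

/-- `J + (24λ₂δ₁)` and `J` agree in even degrees. -/
theorem mem_Jm2_of_even {p : MvPolynomial (Fin 3) ℤ} {n : ℕ} (he : Even n)
    (hp : p ∈ Jm2 ⊔ Ideal.span {24 * X 1 * X 2}) (hn : IsWeightedHomogeneous wt p n) :
    p ∈ Jm2 := by
  obtain ⟨f, hf⟩ := exists_polynomial_of_mem_sup hp hn
  rwa [Finset.sum_eq_zero fun k _ => if_neg (by grind), sub_zero] at hf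

/-- The graded analysis of §5.1: in degrees 4 and 6 the ideal `J + (24λ₂δ₁)`
agrees with `J`, and in degree 5 every element is congruent mod `J` to an
integer multiple of `24λ₂²δ₁`. -/
theorem stmt_7 :
    (∀ p ∈ Jm2 ⊔ Ideal.span ({24 * X 1 * X 2} : Set (MvPolynomial (Fin 3) ℤ)),
      IsWeightedHomogeneous wt p 4 → p ∈ Jm2)
    ∧
    (∀ p ∈ Jm2 ⊔ Ideal.span ({24 * X 1 * X 2} : Set (MvPolynomial (Fin 3) ℤ)),
      IsWeightedHomogeneous wt p 6 → p ∈ Jm2)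
    ∧
    (∀ p ∈ Jm2 ⊔ Ideal.span ({24 * X 1 * X 2} : Set (MvPolynomial (Fin 3) ℤ)),
      IsWeightedHomogeneous wt p 5 →
        ∃ n : ℤ, p - C n * (24 * X 1 ^ 2 * X 2) ∈ Jm2) := by
  refine ⟨fun p hp h => mem_Jm2_of_even (by decide) hp h,
    fun p hp h => mem_Jm2_of_even (by decide) hp h, fun p hp h => ?_⟩
  obtain ⟨f, hf⟩ := exists_polynomial_of_mem_sup hp h
  refine ⟨f.coeff 1, ?_⟩
  convert hf using 2
  rw [Finset.sum_eq_single 1 (fun k _ hk => if_neg (by omega))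
    (fun h1 => by simp [Polynomial.notMem_support_iff.mp h1])]
  simp only [if_true, Nat.reduceMul, Nat.reduceAdd]
  ring
end

section
/- For each integer w ∈ {0,1}: in R, the intersection of the two ideals J_w + (2(δ₁ + λ₁), δ₁(δ₁ + λ₁), 24λ₁λ₂, 144λ₂) and J_w + (24λ₂, 4λ₁ − 2δ₁, 6δ₁², 6λ₂δ₁, 2λ₂δ₁ − 2δ₁³) equals the ideal J_w + (4λ₁(δ₁ + λ₁), 4λ₂(δ₁ + λ₁), 144λ₂). (This is the ideal-intersection computation of §5.2 used to determine the classes β₂ᵢ.) -/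
open MvPolynomial

/-- The ideal `J_w` of relations for `CH*(M̄₂ ∖ (Δ₀₀₀ ∪ Δ₀₀₁))`, in
`R = ℤ[λ₁, λ₂, δ₁]` with `X 0 = λ₁`, `X 1 = λ₂`, `X 2 = δ₁`. -/
noncomputable def Jw (w : ℤ) : Ideal (MvPolynomial (Fin 3) ℤ) :=
  Ideal.span {24 * X 0 ^ 2 - 48 * X 1,
    20 * X 0 * X 1 - 4 * X 2 * X 1,
    X 2 ^ 2 * (X 2 + X 0),
    2 * X 2 * (X 2 + X 0),
    48 * X 2 * X 1,
    C (24 * w) * (X 2 * X 1 ^ 2)}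

theorem MvPolynomial.sub_aeval_mem {σ R : Type*} [CommRing R] {I : Ideal (MvPolynomial σ R)}
    {g : σ → MvPolynomial σ R} (hg : ∀ i, X i - g i ∈ I) (p : MvPolynomial σ R) :
    p - aeval g p ∈ I := by
  rw [← Ideal.Quotient.eq]
  have h : Ideal.Quotient.mkₐ R I = (Ideal.Quotient.mkₐ R I).comp (aeval g) := by
    ext i
    simpa using Ideal.Quotient.eq.mpr (hg i)
  exact DFunLike.congr_fun h p

local notation "l₁" => (X 0 : MvPolynomial (Fin 3) ℤ)
local notation "l₂" => (X 1 : MvPolynomial (Fin 3) ℤ)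
local notation "d₁" => (X 2 : MvPolynomial (Fin 3) ℤ)

theorem prime_two_mvPolynomial : Prime (2 : MvPolynomial (Fin 3) ℤ) := by
  simpa using (prime_C_iff (Fin 3) (r := (2 : ℤ))).mpr Int.prime_two

theorem not_two_dvd_of_aeval_eq_one {p : MvPolynomial (Fin 3) ℤ} (v : Fin 3 → ℤ)
    (h : aeval v p = 1) : ¬ 2 ∣ p := by
  rintro ⟨q, rfl⟩
  rw [map_mul, map_ofNat] at h
  omega

/-- A sufficient set of membership conditions for the second of the two intersected ideals to be
contained in a given ideal. -/
theorem Jw_sup_span_le (w : ℤ) {I : Ideal (MvPolynomial (Fin 3) ℤ)}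
    (h₁ : 24 * l₂ ∈ I) (h₂ : 4 * l₁ - 2 * d₁ ∈ I) (h₃ : 6 * d₁ ^ 2 ∈ I) (h₄ : 6 * l₂ * d₁ ∈ I)
    (h₅ : 2 * l₂ * d₁ - 2 * d₁ ^ 3 ∈ I) (h₆ : d₁ ^ 2 * (d₁ + l₁) ∈ I)
    (h₇ : 2 * d₁ * (d₁ + l₁) ∈ I) :
    Jw w ⊔ Ideal.span {24 * l₂, 4 * l₁ - 2 * d₁, 6 * d₁ ^ 2, 6 * l₂ * d₁,
      2 * l₂ * d₁ - 2 * d₁ ^ 3} ≤ I := by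
  rw [sup_le_iff, Jw, Ideal.span_le, Ideal.span_le]
  simp only [Set.insert_subset_iff, Set.singleton_subset_iff, SetLike.mem_coe]
  refine ⟨⟨?_, ?_, h₆, h₇, ?_, ?_⟩, h₁, h₂, h₃, h₄, h₅⟩
  · convert I.add_mem (I.add_mem (I.mul_mem_left (6 * l₁ + 3 * d₁) h₂) h₃)
      (I.mul_mem_left (-2) h₁) using 1
    ring
  · convert I.add_mem (I.mul_mem_left (5 * l₂) h₂) h₄ using 1
    ring
  · convert I.mul_mem_left (2 * d₁) h₁ using 1
    ring
  · convert I.mul_mem_left (C w * d₁ * l₂) h₁ using 1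
    rw [C_mul, show (C 24 : MvPolynomial (Fin 3) ℤ) = 24 from rfl]
    ring

theorem eq_mul_add_of_mem_sup (w : ℤ) {I : Ideal (MvPolynomial (Fin 3) ℤ)}
    (h₁ : 24 * l₁ ^ 2 - 48 * l₂ ∈ I) (h₂ : 24 * l₁ * l₂ ∈ I) (h₃ : 144 * l₂ ∈ I)
    {f : MvPolynomial (Fin 3) ℤ}
    (hf : f ∈ Jw w ⊔ Ideal.span {2 * (d₁ + l₁), d₁ * (d₁ + l₁), 24 * l₁ * l₂, 144 * l₂}) :
    ∃ p q, f - (d₁ + l₁) * (2 * p + d₁ * q) ∈ I := by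
  have key : Jw w ⊔ Ideal.span {2 * (d₁ + l₁), d₁ * (d₁ + l₁), 24 * l₁ * l₂, 144 * l₂} ≤
      Ideal.span {2 * (d₁ + l₁), d₁ * (d₁ + l₁)} ⊔ I := by
    set K := Ideal.span {2 * (d₁ + l₁), d₁ * (d₁ + l₁)} ⊔ I
    have k₁ : 2 * (d₁ + l₁) ∈ K := Ideal.mem_sup_left (Ideal.subset_span (by simp))
    have k₂ : d₁ * (d₁ + l₁) ∈ K := Ideal.mem_sup_left (Ideal.subset_span (by simp))
    have k₃ : 24 * l₁ * l₂ ∈ K := Ideal.mem_sup_right h₂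
    rw [sup_le_iff, Jw, Ideal.span_le, Ideal.span_le]
    simp only [Set.insert_subset_iff, Set.singleton_subset_iff, SetLike.mem_coe]
    refine ⟨⟨Ideal.mem_sup_right h₁, ?_, ?_, ?_, ?_, ?_⟩, k₁, k₂, k₃, Ideal.mem_sup_right h₃⟩
    · convert K.add_mem (K.mul_mem_left (-2 * l₂) k₁) k₃ using 1
      ring
    · convert K.mul_mem_left d₁ k₂ using 1
      ring
    · convert K.mul_mem_left 2 k₂ using 1
      ring
    · convert K.add_mem (K.mul_mem_left (24 * l₂) k₁) (K.mul_mem_left (-2) k₃) using 1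
      ring
    · convert K.add_mem (K.mul_mem_left (12 * C w * l₂ ^ 2) k₁)
        (K.mul_mem_left (-C w * l₂) k₃) using 1
      rw [C_mul, show (C 24 : MvPolynomial (Fin 3) ℤ) = 24 from rfl]
      ring
  obtain ⟨y, hy, z, hz, rfl⟩ := Submodule.mem_sup.mp (key hf)
  obtain ⟨p, q, rfl⟩ := Ideal.mem_span_pair.mp hy
  refine ⟨p, q, ?_⟩
  convert hz using 1
  ring

/-- If `(δ₁ + λ₁)(2p + δ₁q)` lies in the second ideal, then `q ∈ (2, δ₁)`. -/
theorem mem_span_two_of_mul_mem (w : ℤ) {p q : MvPolynomial (Fin 3) ℤ}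
    (h : (d₁ + l₁) * (2 * p + d₁ * q) ∈ Jw w ⊔ Ideal.span {24 * l₂, 4 * l₁ - 2 * d₁,
      6 * d₁ ^ 2, 6 * l₂ * d₁, 2 * l₂ * d₁ - 2 * d₁ ^ 3}) :
    ∃ y z, q = d₁ * y + 2 * z := by
  have hle := Jw_sup_span_le w (I := Ideal.span {2, d₁ ^ 2 * (d₁ + l₁)})
    (Ideal.mem_span_pair.mpr ⟨12 * l₂, 0, by ring⟩)
    (Ideal.mem_span_pair.mpr ⟨2 * l₁ - d₁, 0, by ring⟩)
    (Ideal.mem_span_pair.mpr ⟨3 * d₁ ^ 2, 0, by ring⟩)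
    (Ideal.mem_span_pair.mpr ⟨3 * l₂ * d₁, 0, by ring⟩)
    (Ideal.mem_span_pair.mpr ⟨l₂ * d₁ - d₁ ^ 3, 0, by ring⟩)
    (Ideal.mem_span_pair.mpr ⟨0, 1, by ring⟩)
    (Ideal.mem_span_pair.mpr ⟨d₁ * (d₁ + l₁), 0, by ring⟩)
  obtain ⟨x, y, hxy⟩ := Ideal.mem_span_pair.mp (hle h)
  have hdvd : 2 ∣ (d₁ * (d₁ + l₁)) * (q - d₁ * y) :=
    ⟨x - (d₁ + l₁) * p, by linear_combination -hxy⟩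
  rcases prime_two_mvPolynomial.dvd_or_dvd hdvd with h' | ⟨z, hz⟩
  · exact absurd h' (not_two_dvd_of_aeval_eq_one ![0, 0, 1] (by simp))
  · exact ⟨y, z, by linear_combination hz⟩

/-- If `2(δ₁ + λ₁)p` lies in the second ideal, then `p ∈ (2, δ₁)`. -/
theorem mem_span_two_of_two_mul_mem (w : ℤ) {p : MvPolynomial (Fin 3) ℤ}
    (h : 2 * (d₁ + l₁) * p ∈ Jw w ⊔ Ideal.span {24 * l₂, 4 * l₁ - 2 * d₁,
      6 * d₁ ^ 2, 6 * l₂ * d₁, 2 * l₂ * d₁ - 2 * d₁ ^ 3}) :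
    ∃ y z, p = d₁ * y + 2 * z := by
  have hle := Jw_sup_span_le w (I := Ideal.span {4, d₁})
    (Ideal.mem_span_pair.mpr ⟨6 * l₂, 0, by ring⟩)
    (Ideal.mem_span_pair.mpr ⟨l₁, -2, by ring⟩)
    (Ideal.mem_span_pair.mpr ⟨0, 6 * d₁, by ring⟩)
    (Ideal.mem_span_pair.mpr ⟨0, 6 * l₂, by ring⟩)
    (Ideal.mem_span_pair.mpr ⟨0, 2 * l₂ - 2 * d₁ ^ 2, by ring⟩)
    (Ideal.mem_span_pair.mpr ⟨0, d₁ * (d₁ + l₁), by ring⟩)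
    (Ideal.mem_span_pair.mpr ⟨0, 2 * (d₁ + l₁), by ring⟩)
  obtain ⟨x, y, hxy⟩ := Ideal.mem_span_pair.mp (hle h)
  let φ : MvPolynomial (Fin 3) ℤ →ₐ[ℤ] MvPolynomial (Fin 3) ℤ := aeval ![l₁, l₂, 0]
  have hφ : φ x * 4 = 2 * l₁ * φ p := by
    have := congrArg φ hxy
    simp only [φ, map_add, map_mul, map_ofNat, aeval_X] at this
    simpa only [Matrix.cons_val, mul_zero, add_zero, zero_add] using this
  have hdvd : 2 ∣ l₁ * φ p :=
    ⟨φ x, mul_left_cancel₀ (two_ne_zero) (by linear_combination -hφ)⟩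
  have hsub : p - φ p ∈ Ideal.span {d₁} := by
    apply MvPolynomial.sub_aeval_mem
    intro i
    fin_cases i <;> simp
  obtain ⟨u, hu⟩ := Ideal.mem_span_singleton.mp hsub
  rcases prime_two_mvPolynomial.dvd_or_dvd hdvd with h' | ⟨z, hz⟩
  · exact absurd h' (not_two_dvd_of_aeval_eq_one ![1, 0, 0] (by simp))
  · exact ⟨u, z, by linear_combination hu + hz⟩

/-- If `4(δ₁ + λ₁)v` lies in the second ideal, then `v` has no constant term. -/
theorem mem_span_X_of_four_mul_mem (w : ℤ) {v : MvPolynomial (Fin 3) ℤ}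
    (h : 4 * (d₁ + l₁) * v ∈ Jw w ⊔ Ideal.span {24 * l₂, 4 * l₁ - 2 * d₁,
      6 * d₁ ^ 2, 6 * l₂ * d₁, 2 * l₂ * d₁ - 2 * d₁ ^ 3}) :
    v ∈ Ideal.span {l₁, l₂, d₁} := by
  let ε : DualNumber ℤ := DualNumber.eps
  have hε : ε * ε = 0 := DualNumber.eps_mul_eps
  let χ : MvPolynomial (Fin 3) ℤ →ₐ[ℤ] DualNumber ℤ := aeval ![ε, 0, 2 * ε]
  have hle := Jw_sup_span_le w (I := RingHom.ker χ)
    (by simp [RingHom.mem_ker, χ])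
    (by simp only [RingHom.mem_ker, χ, map_sub, map_mul, map_ofNat, aeval_X]
        simp only [Matrix.cons_val]
        ring)
    (by simp only [RingHom.mem_ker, χ, map_pow, map_mul, map_ofNat, aeval_X]
        simp only [Matrix.cons_val]
        linear_combination 24 * hε)
    (by simp [RingHom.mem_ker, χ])
    (by simp only [RingHom.mem_ker, χ, map_sub, map_pow, map_mul, map_ofNat, aeval_X]
        simp only [Matrix.cons_val]
        linear_combination (-16 * ε) * hε)
    (by simp only [RingHom.mem_ker, χ, map_add, map_pow, map_mul, aeval_X]
        simp only [Matrix.cons_val]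
        linear_combination (12 * ε) * hε)
    (by simp only [RingHom.mem_ker, χ, map_add, map_mul, map_ofNat, aeval_X]
        simp only [Matrix.cons_val]
        linear_combination 12 * hε)
  have hχ : χ (4 * (d₁ + l₁) * v) = 0 := hle h
  have hsub : v - aeval (fun _ => 0) v ∈ Ideal.span {l₁, l₂, d₁} := by
    apply MvPolynomial.sub_aeval_mem
    intro i
    rw [sub_zero]
    apply Ideal.subset_span
    fin_cases i <;> simp
  have hfst : (χ v).fst = constantCoeff v := by
    have : (TrivSqZeroExt.fstHom ℤ ℤ ℤ).comp χ = aeval (fun _ => 0) := by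
      ext i
      fin_cases i <;> simp [χ, ε]
    simpa [aeval_zero'] using DFunLike.congr_fun this v
  have hmul : χ (4 * (d₁ + l₁) * v) = (12 * ε) * χ v := by
    simp only [χ, map_add, map_mul, map_ofNat, aeval_X]
    simp only [Matrix.cons_val]
    ring
  have hc : constantCoeff v = 0 := by
    have := congrArg TrivSqZeroExt.snd (hmul.symm.trans hχ)
    have h12 : (12 : DualNumber ℤ) = TrivSqZeroExt.inl 12 := rfl
    rw [h12] at this
    simpa [ε, hfst] using this
  rwa [aeval_zero', hc, map_zero, sub_zero] at hsub

/-- The first ideal-intersection computation of §5.2 used to determine the `β₂ᵢ`. -/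
theorem stmt_8 :
    ∀ w : ℤ, (w = 0 ∨ w = 1) →
    (Jw w ⊔ Ideal.span ({2 * (X 2 + X 0),
        X 2 * (X 2 + X 0),
        24 * X 0 * X 1,
        144 * X 1} : Set (MvPolynomial (Fin 3) ℤ)))
    ⊓ (Jw w ⊔ Ideal.span ({24 * X 1,
        4 * X 0 - 2 * X 2,
        6 * X 2 ^ 2,
        6 * X 1 * X 2,
        2 * X 1 * X 2 - 2 * X 2 ^ 3} : Set (MvPolynomial (Fin 3) ℤ))) =
    Jw w ⊔ Ideal.span ({4 * X 0 * (X 2 + X 0),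
        4 * X 1 * (X 2 + X 0),
        144 * X 1} : Set (MvPolynomial (Fin 3) ℤ)) := by
  intro w _
  set B := Jw w ⊔ Ideal.span ({24 * l₂, 4 * l₁ - 2 * d₁, 6 * d₁ ^ 2, 6 * l₂ * d₁,
    2 * l₂ * d₁ - 2 * d₁ ^ 3} : Set (MvPolynomial (Fin 3) ℤ))
  set D := Jw w ⊔ Ideal.span ({4 * l₁ * (d₁ + l₁), 4 * l₂ * (d₁ + l₁), 144 * l₂} :
    Set (MvPolynomial (Fin 3) ℤ))
  have c₁ : 4 * l₁ * (d₁ + l₁) ∈ D := Ideal.mem_sup_right (Ideal.subset_span (by simp))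
  have c₂ : 4 * l₂ * (d₁ + l₁) ∈ D := Ideal.mem_sup_right (Ideal.subset_span (by simp))
  have c₃ : 144 * l₂ ∈ D := Ideal.mem_sup_right (Ideal.subset_span (by simp))
  have c₄ : 24 * l₁ ^ 2 - 48 * l₂ ∈ D := Ideal.mem_sup_left (Ideal.subset_span (by simp))
  have c₅ : 20 * l₁ * l₂ - 4 * d₁ * l₂ ∈ D := Ideal.mem_sup_left (Ideal.subset_span (by simp))
  have c₆ : d₁ ^ 2 * (d₁ + l₁) ∈ D := Ideal.mem_sup_left (Ideal.subset_span (by simp))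
  have c₇ : 2 * d₁ * (d₁ + l₁) ∈ D := Ideal.mem_sup_left (Ideal.subset_span (by simp))
  have c₈ : 24 * l₁ * l₂ ∈ D := by
    convert D.add_mem c₅ c₂ using 1
    ring
  have hDB : D ≤ B := by
    have b₁ : 24 * l₂ ∈ B := Ideal.mem_sup_right (Ideal.subset_span (by simp))
    have b₂ : 4 * l₁ - 2 * d₁ ∈ B := Ideal.mem_sup_right (Ideal.subset_span (by simp))
    have b₃ : 6 * d₁ ^ 2 ∈ B := Ideal.mem_sup_right (Ideal.subset_span (by simp))
    have b₄ : 6 * l₂ * d₁ ∈ B := Ideal.mem_sup_right (Ideal.subset_span (by simp))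
    have b₅ : 2 * d₁ * (d₁ + l₁) ∈ B := Ideal.mem_sup_left (Ideal.subset_span (by simp))
    refine sup_le le_sup_left ?_
    rw [Ideal.span_le]
    simp only [Set.insert_subset_iff, Set.singleton_subset_iff, SetLike.mem_coe]
    refine ⟨?_, ?_, ?_⟩
    · convert B.sub_mem (B.add_mem (B.mul_mem_left l₁ b₂) (B.mul_mem_left 3 b₅)) b₃ using 1
      ring
    · convert B.add_mem (B.mul_mem_left l₂ b₂) b₄ using 1
      ring
    · convert B.mul_mem_left 6 b₁ using 1
      ring
  apply le_antisymm
  · rintro f ⟨hfA, hfB⟩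
    obtain ⟨p, q, hpq⟩ := eq_mul_add_of_mem_sup w c₄ c₈ c₃ hfA
    have hg : (d₁ + l₁) * (2 * p + d₁ * q) ∈ B := by
      convert B.sub_mem hfB (hDB hpq) using 1
      ring
    obtain ⟨y, z, rfl⟩ := mem_span_two_of_mul_mem w hg
    have hq : (d₁ + l₁) * (d₁ * (d₁ * y + 2 * z)) ∈ D := by
      convert D.add_mem (D.mul_mem_left y c₆) (D.mul_mem_left z c₇) using 1
      ring
    have hp : 2 * (d₁ + l₁) * p ∈ B := by
      convert B.sub_mem hg (hDB hq) using 1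
      ring
    obtain ⟨u, v, rfl⟩ := mem_span_two_of_two_mul_mem w hp
    have hu : 2 * d₁ * (d₁ + l₁) * u ∈ D := D.mul_mem_right u c₇
    have hv : 4 * (d₁ + l₁) * v ∈ B := by
      convert B.sub_mem hp (hDB hu) using 1
      ring
    obtain ⟨r, s, t, rfl⟩ := Submodule.mem_span_triple.mp (mem_span_X_of_four_mul_mem w hv)
    convert D.add_mem (D.add_mem (D.add_mem hpq hq) hu) (D.add_mem (D.add_mem
      (D.mul_mem_left r c₁) (D.mul_mem_left s c₂)) (D.mul_mem_left (2 * t) c₇)) using 1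
    simp only [smul_eq_mul]
    ring
  · refine le_inf (sup_le le_sup_left ?_) hDB
    rw [Ideal.span_le]
    set A := Jw w ⊔ Ideal.span ({2 * (d₁ + l₁), d₁ * (d₁ + l₁), 24 * l₁ * l₂, 144 * l₂} :
      Set (MvPolynomial (Fin 3) ℤ))
    have a₁ : 2 * (d₁ + l₁) ∈ A := Ideal.mem_sup_right (Ideal.subset_span (by simp))
    have a₂ : 144 * l₂ ∈ A := Ideal.mem_sup_right (Ideal.subset_span (by simp))
    simp only [Set.insert_subset_iff, Set.singleton_subset_iff, SetLike.mem_coe]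
    refine ⟨?_, ?_, a₂⟩
    · convert A.mul_mem_left (2 * l₁) a₁ using 1
      ring
    · convert A.mul_mem_left (2 * l₂) a₁ using 1
      ring
end

section
/- For each integer w ∈ {0,1}: in R, the intersection of the ideals J_w + (4λ₁(δ₁ + λ₁), 4λ₂(δ₁ + λ₁), 144λ₂) and J_w + (δ₁) equals the ideal J_w + (24λ₂δ₁, 72δ₁²). (This is the second ideal-intersection computation of §5.2.) -/
open MvPolynomial

/-- A nonzero constant and a variable outside `s` may be cancelled modulo the ideal generated by
the variables in `s`. -/
theorem mem_span_X_image_of_C_mul_X_mul_mem {σ R : Type*} [CommRing R] [NoZeroDivisors R]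
    {s : Set σ} {j : σ} (hj : j ∉ s) {c : R} (hc : c ≠ 0) {f : MvPolynomial σ R}
    (h : C c * (X j * f) ∈ Ideal.span (X '' s : Set (MvPolynomial σ R))) :
    f ∈ Ideal.span (X '' s : Set (MvPolynomial σ R)) := by
  classical
  rw [mem_ideal_span_X_image] at h ⊢
  intro m hm
  rw [mem_support_iff] at hm
  obtain ⟨i, hi, hmi⟩ := h (Finsupp.single j 1 + m) (by
    rw [mem_support_iff, coeff_C_mul, coeff_X_mul]
    exact mul_ne_zero hc hm)
  have hij : j ≠ i := fun e => hj (e ▸ hi)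
  exact ⟨i, hi, by simpa [Finsupp.single_apply, hij] using hmi⟩

theorem X_dvd_of_X_dvd_C_mul_X_mul {σ R : Type*} [CommRing R] [NoZeroDivisors R]
    {i j : σ} (hij : j ≠ i) {c : R} (hc : c ≠ 0) {f : MvPolynomial σ R}
    (h : X i ∣ C c * (X j * f)) : X i ∣ f := by
  have key := mem_span_X_image_of_C_mul_X_mul_mem (s := {i}) (by simpa using hij) hc (f := f)
  simp only [Set.image_singleton, Ideal.mem_span_singleton] at key
  exact key h

theorem exists_eq_of_C_mul_X_mul_eq {σ R : Type*} [CommRing R] [NoZeroDivisors R]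
    {i j k : σ} (hji : j ≠ i) (hjk : j ≠ k) {c : R} (hc : c ≠ 0) {f a b : MvPolynomial σ R}
    (h : C c * (X j * f) = a * X i + b * X k) :
    ∃ a' b', f = a' * X i + b' * X k := by
  have key := mem_span_X_image_of_C_mul_X_mul_mem (s := {i, k}) (j := j)
    (by simp [hji, hjk]) hc (f := f)
  simp only [Set.image_pair, Ideal.mem_span_pair] at key
  obtain ⟨a', b', h'⟩ := key ⟨a, b, h.symm⟩
  exact ⟨a', b', h'.symm⟩

/-- The solutions of the linear equation expressing that
`4 * X 0 ^ 2 * p + 4 * X 0 * X 1 * q + 144 * X 1 * r` lies in the ideal generated by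
`24 * X 0 ^ 2 - 48 * X 1`, `20 * X 0 * X 1` and `X 2`. -/
theorem exists_syzygy {p q r u v t : MvPolynomial (Fin 3) ℤ}
    (h : 4 * X 0 ^ 2 * p + 4 * X 0 * X 1 * q + 144 * X 1 * r =
      u * (24 * X 0 ^ 2 - 48 * X 1) + (v * (20 * X 0 * X 1) + t * X 2)) :
    ∃ a b c e, p = -18 * r + 6 * X 0 * a + X 1 * b + X 2 * c ∧
      q = 5 * v - 12 * a - X 0 * b + X 2 * e := by
  have C48 : (C 48 : MvPolynomial (Fin 3) ℤ) = 48 := rfl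
  have C4 : (C 4 : MvPolynomial (Fin 3) ℤ) = 4 := rfl
  have C1 : (C 1 : MvPolynomial (Fin 3) ℤ) = 1 := rfl
  obtain ⟨a, d, hu⟩ := exists_eq_of_C_mul_X_mul_eq (i := (0 : Fin 3)) (j := 1) (k := 2)
    (by decide) (by decide) (c := (48 : ℤ)) (by norm_num) (f := 3 * r + u)
    (a := 24 * X 0 * u + 20 * v * X 1 - 4 * X 0 * p - 4 * X 1 * q) (b := t)
    (by rw [C48]; linear_combination h)
  have hdvd : (X 2 : MvPolynomial (Fin 3) ℤ) ∣
      X 0 * (p + 18 * r - 6 * X 0 * a) + X 1 * (q + 12 * a - 5 * v) := by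
    refine X_dvd_of_X_dvd_C_mul_X_mul (j := (0 : Fin 3)) (by decide) (c := (4 : ℤ))
      (by norm_num) ⟨t + d * (24 * X 0 ^ 2 - 48 * X 1), ?_⟩
    rw [C4]
    linear_combination h + (24 * X 0 ^ 2 - 48 * X 1) * hu
  obtain ⟨g, hg⟩ := hdvd
  obtain ⟨b, c, hp⟩ := exists_eq_of_C_mul_X_mul_eq (i := (1 : Fin 3)) (j := 0) (k := 2)
    (by decide) (by decide) (c := (1 : ℤ)) (by norm_num) (f := p + 18 * r - 6 * X 0 * a)
    (a := -(q + 12 * a - 5 * v)) (b := g)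
    (by rw [C1]; linear_combination hg)
  obtain ⟨e, he⟩ : (X 2 : MvPolynomial (Fin 3) ℤ) ∣ X 0 * b + (q + 12 * a - 5 * v) := by
    refine X_dvd_of_X_dvd_C_mul_X_mul (j := (1 : Fin 3)) (by decide) (c := (1 : ℤ))
      (by norm_num) ⟨g - X 0 * c, ?_⟩
    rw [C1]
    linear_combination hg - X 0 * hp
  exact ⟨a, b, c, e, by linear_combination hp, by linear_combination he⟩

theorem Jw_sup_span_X_two_le (w : ℤ) :
    Jw w ⊔ Ideal.span {X 2} ≤
      Ideal.span {24 * X 0 ^ 2 - 48 * X 1, 20 * X 0 * X 1, X 2} := by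
  refine sup_le (Ideal.span_le.2 ?_) (Ideal.span_mono (by simp))
  rintro f (rfl | rfl | rfl | rfl | rfl | rfl) <;>
    simp only [SetLike.mem_coe, Ideal.mem_span_insert, Ideal.mem_span_singleton']
  · exact ⟨1, 0, ⟨0, 0, ⟨0, by ring⟩, by ring⟩, by ring⟩
  · exact ⟨0, _, ⟨1, _, ⟨-4 * X 1, rfl⟩, rfl⟩, by ring⟩
  · exact ⟨0, _, ⟨0, _, ⟨X 2 * (X 2 + X 0), rfl⟩, rfl⟩, by ring⟩
  · exact ⟨0, _, ⟨0, _, ⟨2 * (X 2 + X 0), rfl⟩, rfl⟩, by ring⟩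
  · exact ⟨0, _, ⟨0, _, ⟨48 * X 1, rfl⟩, rfl⟩, by ring⟩
  · exact ⟨0, _, ⟨0, _, ⟨C (24 * w) * X 1 ^ 2, rfl⟩, rfl⟩, by ring⟩

/-- The second ideal-intersection computation of §5.2. -/
theorem stmt_9 :
    ∀ w : ℤ, (w = 0 ∨ w = 1) →
    (Jw w ⊔ Ideal.span ({4 * X 0 * (X 2 + X 0),
        4 * X 1 * (X 2 + X 0),
        144 * X 1} : Set (MvPolynomial (Fin 3) ℤ)))
    ⊓ (Jw w ⊔ Ideal.span ({X 2} : Set (MvPolynomial (Fin 3) ℤ))) =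
    Jw w ⊔ Ideal.span ({24 * X 1 * X 2,
        72 * X 2 ^ 2} : Set (MvPolynomial (Fin 3) ℤ)) := by
  intro w _
  set K := Jw w ⊔ Ideal.span ({24 * X 1 * X 2,
    72 * X 2 ^ 2} : Set (MvPolynomial (Fin 3) ℤ))
  have hJ₁ : 24 * X 0 ^ 2 - 48 * X 1 ∈ Jw w := Ideal.subset_span (by simp)
  have hJ₂ : 20 * X 0 * X 1 - 4 * X 2 * X 1 ∈ Jw w := Ideal.subset_span (by simp)
  have hJ₄ : 2 * X 2 * (X 2 + X 0) ∈ Jw w := Ideal.subset_span (by simp)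
  have hJK : Jw w ≤ K := le_sup_left
  have hK₁ : 24 * X 1 * X 2 ∈ K := Ideal.mem_sup_right (Ideal.subset_span (by simp))
  have hK₂ : 72 * X 2 ^ 2 ∈ K := Ideal.mem_sup_right (Ideal.subset_span (by simp))
  apply le_antisymm
  · rintro f ⟨hfA, hfB⟩
    obtain ⟨j, hj, g, hg, rfl⟩ := Submodule.mem_sup.1 hfA
    refine K.add_mem (hJK hj) ?_
    have hgB := Jw_sup_span_X_two_le w
      ((Ideal.add_mem_iff_right _ (Ideal.mem_sup_left hj)).1 hfB)
    simp only [Ideal.mem_span_insert, Ideal.mem_span_singleton'] at hg hgB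
    obtain ⟨p, _, ⟨q, _, ⟨r, rfl⟩, rfl⟩, rfl⟩ := hg
    obtain ⟨u, _, ⟨v, _, ⟨t, rfl⟩, rfl⟩, h⟩ := hgB
    obtain ⟨a, b, c, e, rfl, rfl⟩ := exists_syzygy (p := p) (q := q) (r := r) (u := u) (v := v)
      (t := t - 4 * X 0 * p - 4 * X 1 * q) (by linear_combination h)
    have key := K.add_mem
      (K.add_mem (K.mul_mem_left (-3 * r + a * (X 2 + X 0)) (hJK hJ₁))
        (K.mul_mem_left v (hJK hJ₂)))
      (K.add_mem (K.mul_mem_left (-36 * r + 2 * X 0 * c + 2 * X 1 * e) (hJK hJ₄))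
        (K.add_mem (K.mul_mem_left v hK₁) (K.mul_mem_left r hK₂)))
    convert key using 1
    ring
  · refine sup_le (le_inf le_sup_left le_sup_left) (Ideal.span_le.2 ?_)
    have hX (g : MvPolynomial (Fin 3) ℤ) : g * X 2 ∈ Jw w ⊔ Ideal.span {X 2} :=
      Ideal.mul_mem_left _ g (Ideal.mem_sup_right (Ideal.mem_span_singleton_self _))
    set A := Jw w ⊔ Ideal.span ({4 * X 0 * (X 2 + X 0), 4 * X 1 * (X 2 + X 0),
      144 * X 1} : Set (MvPolynomial (Fin 3) ℤ))
    have hJA : Jw w ≤ A := le_sup_left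
    have hA₁ : 4 * X 0 * (X 2 + X 0) ∈ A := Ideal.mem_sup_right (Ideal.subset_span (by simp))
    have hA₂ : 4 * X 1 * (X 2 + X 0) ∈ A := Ideal.mem_sup_right (Ideal.subset_span (by simp))
    have hA₃ : 144 * X 1 ∈ A := Ideal.mem_sup_right (Ideal.subset_span (by simp))
    rintro f (rfl | rfl) <;> rw [SetLike.mem_coe, Ideal.mem_inf]
    · refine ⟨?_, hX _⟩
      have key := A.sub_mem (A.mul_mem_left 5 hA₂) (hJA hJ₂)
      convert key using 1
      ring
    · refine ⟨?_, by rw [sq, ← mul_assoc]; exact hX _⟩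
      have key := A.add_mem
        (A.sub_mem (A.mul_mem_left 36 (hJA hJ₄)) (A.mul_mem_left 18 hA₁))
        (A.add_mem (A.mul_mem_left 3 (hJA hJ₁)) hA₃)
      convert key using 1
      ring
end

section
/- For each integer w ∈ {0,1}, in R graded as indicated: every homogeneous element of weighted degree 4 of the ideal J_w + (24λ₂δ₁, 72δ₁²) lies in J_w, and every homogeneous element of weighted degree 3 of J_w + (24λ₂δ₁, 72δ₁²) is congruent modulo J_w to n·(24λ₂δ₁) for some integer n. (This is the graded analysis of §5.2 showing β₂₂ = 0 and β₂₁ = 24x·λ₂δ₁.) -/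
open MvPolynomial

section WeightedComponents

variable {σ R : Type*} [CommRing R] {w : σ → ℕ}

attribute [local instance] MvPolynomial.weightedGradedAlgebra

theorem weightedHomogeneousComponent_mul_of_right {b : MvPolynomial σ R} {j : ℕ}
    (hb : IsWeightedHomogeneous w b j) (a : MvPolynomial σ R) (i : ℕ) :
    weightedHomogeneousComponent w (i + j) (a * b) =
      weightedHomogeneousComponent w i a * b := by
  have h := DirectSum.coe_decompose_mul_add_of_right_mem
    (weightedHomogeneousSubmodule R w) (i := i) (a := a) (b := b) (j := j) hb
  rw [← weightedDecomposition.decompose'_apply, ← weightedDecomposition.decompose'_apply]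
  exact h

theorem isHomogeneous_span_of_isWeightedHomogeneous {s : Set (MvPolynomial σ R)}
    (h : ∀ x ∈ s, ∃ n, IsWeightedHomogeneous w x n) :
    (Ideal.span s).IsHomogeneous (weightedHomogeneousSubmodule R w) :=
  Ideal.homogeneous_span _ _ h

/-- A weighted homogeneous polynomial of positive degree `n` multiplies `b` into `I` as soon as
every variable of weight at most `n` does. -/
theorem mul_mem_of_forall_X_mul_mem {I : Ideal (MvPolynomial σ R)}
    {q b : MvPolynomial σ R} {n : ℕ} (hq : IsWeightedHomogeneous w q n) (hn : n ≠ 0)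
    (h : ∀ i, w i ≤ n → X i * b ∈ I) : q * b ∈ I := by
  have hmem : q ∈ Ideal.span (X '' {i | w i ≤ n} : Set (MvPolynomial σ R)) := by
    rw [mem_ideal_span_X_image]
    intro m hm
    have hwt : Finsupp.weight w m = n := hq (mem_support_iff.mp hm)
    have hm0 : m ≠ 0 := by
      rintro rfl
      exact hn (by simpa using hwt.symm)
    obtain ⟨i, hi⟩ := Finsupp.ne_iff.mp hm0
    exact ⟨i, hwt ▸ Finsupp.le_weight_of_ne_zero' w hi, hi⟩
  have hle : Ideal.span (X '' {i | w i ≤ n}) ≤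
      Submodule.comap (LinearMap.mulRight (MvPolynomial σ R) b) I := by
    rw [Ideal.span_le]
    rintro _ ⟨i, hi, rfl⟩
    exact h i hi
  exact hle hmem

end WeightedComponents

theorem isWeightedHomogeneous_ofNat_mul {p : MvPolynomial (Fin 3) ℤ} {n : ℕ}
    (hp : IsWeightedHomogeneous wt p n) (k : ℕ) [k.AtLeastTwo] :
    IsWeightedHomogeneous wt ((OfNat.ofNat k : MvPolynomial (Fin 3) ℤ) * p) n := by
  simpa using hp.C_mul (OfNat.ofNat k : ℤ)

theorem Jw_isHomogeneous (w : ℤ) :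
    letI := weightedGradedAlgebra ℤ wt
    (Jw w).IsHomogeneous (weightedHomogeneousSubmodule ℤ wt) := by
  have h0 : IsWeightedHomogeneous wt (X 0 : MvPolynomial (Fin 3) ℤ) 1 :=
    isWeightedHomogeneous_X ℤ wt 0
  have h1 : IsWeightedHomogeneous wt (X 1 : MvPolynomial (Fin 3) ℤ) 2 :=
    isWeightedHomogeneous_X ℤ wt 1
  have h2 : IsWeightedHomogeneous wt (X 2 : MvPolynomial (Fin 3) ℤ) 1 :=
    isWeightedHomogeneous_X ℤ wt 2
  refine isHomogeneous_span_of_isWeightedHomogeneous ?_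
  rintro x (rfl | rfl | rfl | rfl | rfl | rfl)
  · exact ⟨2, (isWeightedHomogeneous_ofNat_mul (h0.pow 2) 24).sub
      (isWeightedHomogeneous_ofNat_mul h1 48)⟩
  · exact ⟨3, ((isWeightedHomogeneous_ofNat_mul h0 20).mul h1).sub
      ((isWeightedHomogeneous_ofNat_mul h2 4).mul h1)⟩
  · exact ⟨3, (h2.pow 2).mul (h2.add h0)⟩
  · exact ⟨2, (isWeightedHomogeneous_ofNat_mul h2 2).mul (h2.add h0)⟩
  · exact ⟨3, (isWeightedHomogeneous_ofNat_mul h2 48).mul h1⟩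
  · exact ⟨5, (h2.mul (h1.pow 2)).C_mul _⟩

section Relations

variable (w : ℤ)

theorem X_zero_mul_mem_Jw : X 0 * (24 * X 1 * X 2) ∈ Jw w := by
  have h₁ : 20 * X 0 * X 1 - 4 * X 2 * X 1 ∈ Jw w := Ideal.subset_span (by simp)
  have h₂ : 2 * X 2 * (X 2 + X 0) ∈ Jw w := Ideal.subset_span (by simp)
  convert add_mem ((Jw w).mul_mem_left (X 2) h₁) ((Jw w).mul_mem_left (2 * X 1) h₂) using 1
  ring

theorem X_two_mul_mem_Jw : X 2 * (24 * X 1 * X 2) ∈ Jw w := by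
  have h : 2 * X 2 * (X 2 + X 0) ∈ Jw w := Ideal.subset_span (by simp)
  convert sub_mem ((Jw w).mul_mem_left (12 * X 1) h) (X_zero_mul_mem_Jw w) using 1
  ring

theorem X_zero_mul_sq_mem_Jw : X 0 * (72 * X 2 ^ 2) ∈ Jw w := by
  have h₁ : 24 * X 0 ^ 2 - 48 * X 1 ∈ Jw w := Ideal.subset_span (by simp)
  have h₂ : 2 * X 2 * (X 2 + X 0) ∈ Jw w := Ideal.subset_span (by simp)
  have h₃ : 48 * X 2 * X 1 ∈ Jw w := Ideal.subset_span (by simp)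
  convert sub_mem (sub_mem ((Jw w).mul_mem_left (36 * X 0) h₂)
    ((Jw w).mul_mem_left (3 * X 2) h₁)) ((Jw w).mul_mem_left 3 h₃) using 1
  ring

theorem X_mul_sq_mem_Jw (i : Fin 3) : X i * (72 * X 2 ^ 2) ∈ Jw w := by
  fin_cases i
  · exact X_zero_mul_sq_mem_Jw w
  · convert (Jw w).mul_mem_left 3 (X_two_mul_mem_Jw w) using 1
    simp only [Fin.mk_one]
    ring
  · have h : 2 * X 2 * (X 2 + X 0) ∈ Jw w := Ideal.subset_span (by simp)
    convert sub_mem ((Jw w).mul_mem_left (36 * X 2) h) (X_zero_mul_sq_mem_Jw w) using 1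
    simp only [Fin.reduceFinMk]
    ring

end Relations

/-- The degree `n + 3` part of `J_w + (24λ₂δ₁, 72δ₁²)` is generated modulo `J_w` by `24λ₂δ₁`. -/
theorem exists_sub_mul_mem_Jw {w : ℤ} {p : MvPolynomial (Fin 3) ℤ} {n : ℕ}
    (hp : p ∈ Jw w ⊔ Ideal.span ({24 * X 1 * X 2,
      72 * X 2 ^ 2} : Set (MvPolynomial (Fin 3) ℤ)))
    (hpn : IsWeightedHomogeneous wt p (n + 3)) :
    ∃ a : MvPolynomial (Fin 3) ℤ,
      p - weightedHomogeneousComponent wt n a * (24 * X 1 * X 2) ∈ Jw w := by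
  obtain ⟨j, hj, q, hq, rfl⟩ := Submodule.mem_sup.mp hp
  obtain ⟨a, b, rfl⟩ := Ideal.mem_span_pair.mp hq
  have h1 : IsWeightedHomogeneous wt (X 1 : MvPolynomial (Fin 3) ℤ) 2 :=
    isWeightedHomogeneous_X ℤ wt 1
  have h2 : IsWeightedHomogeneous wt (X 2 : MvPolynomial (Fin 3) ℤ) 1 :=
    isWeightedHomogeneous_X ℤ wt 2
  have hA : IsWeightedHomogeneous wt (24 * X 1 * X 2 : MvPolynomial (Fin 3) ℤ) 3 :=
    (isWeightedHomogeneous_ofNat_mul h1 24).mul h2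
  have hB : IsWeightedHomogeneous wt (72 * X 2 ^ 2 : MvPolynomial (Fin 3) ℤ) 2 :=
    isWeightedHomogeneous_ofNat_mul (h2.pow 2) 72
  refine ⟨a, ?_⟩
  have hb : weightedHomogeneousComponent wt (n + 1) b * (72 * X 2 ^ 2) ∈ Jw w :=
    mul_mem_of_forall_X_mul_mem (weightedHomogeneousComponent_isWeightedHomogeneous (n + 1) b)
      n.succ_ne_zero fun i _ => X_mul_sq_mem_Jw w i
  rw [← weightedHomogeneousComponent_mul_of_right hB] at hb
  rw [← weightedHomogeneousComponent_mul_of_right hA, ← hpn.weightedHomogeneousComponent_same]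
  convert add_mem (weightedHomogeneousComponent_mem_of_mem ℤ wt (Jw_isHomogeneous w) hj (n + 3))
    hb using 1
  simp only [map_add]
  ring

/-- The graded analysis of §5.2: in degree 4 the ideal `J_w + (24λ₂δ₁, 72δ₁²)`
agrees with `J_w`, and in degree 3 every element is congruent mod `J_w` to an
integer multiple of `24λ₂δ₁`. -/
theorem stmt_10 :
    ∀ w : ℤ, (w = 0 ∨ w = 1) →
    (∀ p ∈ Jw w ⊔ Ideal.span ({24 * X 1 * X 2,
        72 * X 2 ^ 2} : Set (MvPolynomial (Fin 3) ℤ)),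
      IsWeightedHomogeneous wt p 4 → p ∈ Jw w)
    ∧
    (∀ p ∈ Jw w ⊔ Ideal.span ({24 * X 1 * X 2,
        72 * X 2 ^ 2} : Set (MvPolynomial (Fin 3) ℤ)),
      IsWeightedHomogeneous wt p 3 →
        ∃ n : ℤ, p - C n * (24 * X 1 * X 2) ∈ Jw w) := by
  intro w _
  refine ⟨fun p hp hp4 => ?_, fun p hp hp3 => ?_⟩
  · obtain ⟨a, ha⟩ := exists_sub_mul_mem_Jw (n := 1) hp hp4
    refine (Submodule.sub_mem_iff_left _ ?_).mp ha
    refine mul_mem_of_forall_X_mul_mem (weightedHomogeneousComponent_isWeightedHomogeneous 1 a)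
      one_ne_zero fun i hi => ?_
    fin_cases i
    · exact X_zero_mul_mem_Jw w
    · simp [wt] at hi
    · exact X_two_mul_mem_Jw w
  · obtain ⟨a, ha⟩ := exists_sub_mul_mem_Jw (n := 0) hp hp3
    refine ⟨coeff 0 a, ?_⟩
    rwa [weightedHomogeneousComponent_zero] at ha
    decide
end

section
/- In R, the ideal (2(δ₁ + λ₁), δ₁(δ₁ + λ₁), 12λ₁, 24λ₂) equals the ideal M + (2(δ₁ + λ₁), δ₁(δ₁ + λ₁), 12δ₁, 24λ₂). (This expresses the computation, in §5.3, of the kernel of the restriction map CH*(M̄₂ ∖ (Δ₀₀ ∪ Δ₀₁)) → CH*(Δ₁ ∖ Δ₀₁).) -/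
open MvPolynomial

/-- The ideal `M` of relations for `CH*(M̄₂ ∖ (Δ₀₀ ∪ Δ₀₁))`, in
`R = ℤ[λ₁, λ₂, δ₁]` with `X 0 = λ₁`, `X 1 = λ₂`, `X 2 = δ₁`. -/
noncomputable def Mct : Ideal (MvPolynomial (Fin 3) ℤ) :=
  Ideal.span {24 * X 0 ^ 2 - 48 * X 1,
    20 * X 0 * X 1 - 4 * X 2 * X 1,
    X 2 ^ 3 + X 2 ^ 2 * X 0,
    2 * X 2 ^ 2 + 2 * X 2 * X 0,
    12 * X 2 * X 0,
    24 * X 2 * X 1,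
    60 * X 0 ^ 2 - 12 * X 2 * X 0}

/-- The kernel computation of §5.3 for `CH*(M̄₂ ∖ (Δ₀₀ ∪ Δ₀₁)) → CH*(Δ₁ ∖ Δ₀₁)`. -/
theorem stmt_11 :
    Ideal.span ({2 * (X 2 + X 0),
        X 2 * (X 2 + X 0),
        12 * X 0,
        24 * X 1} : Set (MvPolynomial (Fin 3) ℤ)) =
    Mct ⊔ Ideal.span ({2 * (X 2 + X 0),
        X 2 * (X 2 + X 0),
        12 * X 2,
        24 * X 1} : Set (MvPolynomial (Fin 3) ℤ)) := by
  apply le_antisymm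
  · rw [Ideal.span_le]
    refine subset_trans ?_ (SetLike.coe_subset_coe.mpr le_sup_right)
    rintro p (rfl | rfl | rfl | rfl)
    · exact Ideal.subset_span (by simp)
    · exact Ideal.subset_span (by simp)
    · rw [SetLike.mem_coe, show (12 * X 0 : MvPolynomial (Fin 3) ℤ) =
        6 * (2 * (X 2 + X 0)) - 12 * X 2 by ring]
      exact Ideal.sub_mem _ (Ideal.mul_mem_left _ _ (Ideal.subset_span (by simp)))
        (Ideal.subset_span (by simp))
    · exact Ideal.subset_span (by simp)
  · set I := Ideal.span ({2 * (X 2 + X 0), X 2 * (X 2 + X 0), 12 * X 0, 24 * X 1} :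
      Set (MvPolynomial (Fin 3) ℤ))
    have h₁ : 2 * (X 2 + X 0) ∈ I := Ideal.subset_span (by simp)
    have h₂ : X 2 * (X 2 + X 0) ∈ I := Ideal.subset_span (by simp)
    have h₃ : 12 * X 0 ∈ I := Ideal.subset_span (by simp)
    have h₄ : 24 * X 1 ∈ I := Ideal.subset_span (by simp)
    refine sup_le ?_ ?_
    · rw [Mct, Ideal.span_le]
      rintro p (rfl | rfl | rfl | rfl | rfl | rfl | rfl) <;> rw [SetLike.mem_coe]
      · convert I.sub_mem (I.mul_mem_left (2 * X 0) h₃) (I.mul_mem_left 2 h₄) using 1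
        ring
      · convert I.sub_mem (I.mul_mem_left (X 0) h₄) (I.mul_mem_left (2 * X 1) h₁) using 1
        ring
      · convert I.mul_mem_left (X 2) h₂ using 1
        ring
      · convert I.mul_mem_left 2 h₂ using 1
        ring
      · convert I.mul_mem_left (X 2) h₃ using 1
        ring
      · convert I.mul_mem_left (X 2) h₄ using 1
        ring
      · convert I.mul_mem_left (5 * X 0 - X 2) h₃ using 1
        ring
    · rw [Ideal.span_le]
      rintro p (rfl | rfl | rfl | rfl) <;> rw [SetLike.mem_coe]
      · exact h₁
      · exact h₂
      · convert I.sub_mem (I.mul_mem_left 6 h₁) h₃ using 1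
        ring
      · exact h₄
end

section
/- In R, the polynomial 2λ₁² − 24λ₂ + δ₁λ₁ − δ₁² does NOT lie in the ideal M + (10λ₁ − 2δ₁, 2λ₁² − 24λ₂ + 2δ₁λ₁). (This is the non-membership claim in §5.3 which forces the coefficient b = −1 in the determination of β₁₁.) -/
open MvPolynomial

open scoped DualNumber

/-- The point `λ₁ = 1, λ₂ = 0, δ₁ = ε` with values in the dual numbers over `𝔽₂`. -/
noncomputable def dualNumberEval : MvPolynomial (Fin 3) ℤ →+* (ZMod 2)[ε] :=
  eval₂Hom (Int.castRingHom _) ![1, 0, DualNumber.eps]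

theorem dualNumber_two_eq_zero : (2 : (ZMod 2)[ε]) = 0 :=
  TrivSqZeroExt.ext (by decide) (by decide)

@[simp] theorem dualNumberEval_X_zero : dualNumberEval (X 0) = 1 := by
  simp [dualNumberEval]

@[simp] theorem dualNumberEval_X_one : dualNumberEval (X 1) = 0 := by
  simp [dualNumberEval]

@[simp] theorem dualNumberEval_X_two : dualNumberEval (X 2) = DualNumber.eps := by
  simp [dualNumberEval]

theorem relations_le_ker_dualNumberEval :
    Mct ⊔ Ideal.span ({10 * X 0 - 2 * X 2,
      2 * X 0 ^ 2 - 24 * X 1 + 2 * X 2 * X 0} : Set (MvPolynomial (Fin 3) ℤ)) ≤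
      RingHom.ker dualNumberEval := by
  have h2 := dualNumber_two_eq_zero
  have hε : (DualNumber.eps : (ZMod 2)[ε]) * DualNumber.eps = 0 := DualNumber.eps_mul_eps
  rw [Mct, sup_le_iff, Ideal.span_le, Ideal.span_le]
  simp only [Set.insert_subset_iff, Set.singleton_subset_iff, SetLike.mem_coe, RingHom.mem_ker,
    map_add, map_sub, map_mul, map_pow, map_ofNat, dualNumberEval_X_zero, dualNumberEval_X_one,
    dualNumberEval_X_two]
  refine ⟨⟨?_, ?_, ?_, ?_, ?_, ?_, ?_⟩, ?_, ?_⟩ <;> grind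

/-- The non-membership claim of §5.3 forcing the coefficient `b = −1` for `β₁₁`. -/
theorem stmt_12 :
    2 * X 0 ^ 2 - 24 * X 1 + X 2 * X 0 - X 2 ^ 2 ∉
      Mct ⊔ Ideal.span ({10 * X 0 - 2 * X 2,
        2 * X 0 ^ 2 - 24 * X 1 + 2 * X 2 * X 0} : Set (MvPolynomial (Fin 3) ℤ)) := by
  intro h
  have h := RingHom.mem_ker.mp (relations_le_ker_dualNumberEval h)
  simp only [map_add, map_sub, map_mul, map_ofNat, dualNumberEval_X_zero,
    dualNumberEval_X_one, dualNumberEval_X_two, dualNumber_two_eq_zero, pow_two,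
    DualNumber.eps_mul_eps] at h
  simpa using congrArg TrivSqZeroExt.snd h
end

section
/- In ℤ[λ₁, λ₂], the ideal (24λ₁² − 48λ₂, 20λ₁λ₂, −12λ₁² + 144λ₂, 24λ₁³ − 168λ₁λ₂, −24λ₁⁴ + 148λ₁²λ₂) equals the ideal (24λ₁² − 48λ₂, 20λ₁λ₂, 60λ₁²). (This is the presentation of the integral Chow ring of M̄₂ ∖ (Δ₀₀ ∪ Δ₁), obtained by quotienting the presentation of CH*(M̄₂ ∖ Δ₁) by the classes α₂₀, α₂₁, α₂₂, as in Theorem 5.4.) -/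
open MvPolynomial

/-- `X 0 = λ₁`, `X 1 = λ₂` in `ℤ[λ₁, λ₂]`.
The presentation of `CH*(M̄₂ ∖ (Δ₀₀ ∪ Δ₁))` from Theorem 5.4. -/
theorem stmt_14 :
    Ideal.span ({24 * X 0 ^ 2 - 48 * X 1,
        20 * X 0 * X 1,
        -12 * X 0 ^ 2 + 144 * X 1,
        24 * X 0 ^ 3 - 168 * X 0 * X 1,
        -24 * X 0 ^ 4 + 148 * X 0 ^ 2 * X 1} : Set (MvPolynomial (Fin 2) ℤ)) =
    Ideal.span ({24 * X 0 ^ 2 - 48 * X 1,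
        20 * X 0 * X 1,
        60 * X 0 ^ 2} : Set (MvPolynomial (Fin 2) ℤ)) := by
  apply le_antisymm <;> rw [Ideal.span_le]
  · rintro p (rfl | rfl | rfl | rfl | rfl) <;>
      rw [SetLike.mem_coe, Submodule.mem_span_triple]
    · exact ⟨1, 0, 0, by simp only [smul_eq_mul]; ring⟩
    · exact ⟨0, 1, 0, by simp only [smul_eq_mul]; ring⟩
    · exact ⟨-3, 0, 1, by simp only [smul_eq_mul]; ring⟩
    · exact ⟨X 0, -6, 0, by simp only [smul_eq_mul]; ring⟩
    · exact ⟨-X 0 ^ 2, 5 * X 0, 0, by simp only [smul_eq_mul]; ring⟩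
  · rintro p (rfl | rfl | rfl)
    · exact Ideal.subset_span (by simp)
    · exact Ideal.subset_span (by simp)
    · have h : (60 * X 0 ^ 2 : MvPolynomial (Fin 2) ℤ) =
          3 * (24 * X 0 ^ 2 - 48 * X 1) + (-12 * X 0 ^ 2 + 144 * X 1) := by ring
      rw [h]
      exact add_mem (Ideal.mul_mem_left _ _ (Ideal.subset_span (by simp)))
        (Ideal.subset_span (by simp))
end

section
/- In S, set α₁ := −2λ₁ + δ₁ + γ, α₂ := 2δ₁λ₁ − 2λ₁γ − 8λ₂, β₁ := 3λ₁ − 2δ₁, β₂ := 2λ₁² − 3δ₁λ₁ + δ₁² + λ₁γ + γ² + λ₂. Then: (i) 12α₂ + 4α₁² + 4α₁(β₁ + γ) + 16λ₁² − 20δ₁λ₁ ∈ I_B; (ii) (6α₂ + 2α₁²)(β₁ + γ) + 8α₁β₂ ∈ I_B; (iii) 10α₁α₂ + 6α₂(β₁ + γ) ∈ I_B; (iv) 5α₁α₂(β₁ + γ) + 12α₂β₂ ∈ I_B. (This is the conclusion of §4.4: of the four norm-pushforward relations excising π⁻¹(Δ₀₀₀) from B, the last three already vanish in CH*(B) and the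 first equals −16λ₁² + 20δ₁λ₁.) -/
open MvPolynomial

/-- `α₁ = −2λ₁ + δ₁ + γ` (Lemma 4.7). -/
noncomputable def a1 : MvPolynomial (Fin 4) ℤ := -2 * X 2 + X 1 + X 0

/-- `α₂ = 2δ₁λ₁ − 2λ₁γ − 8λ₂` (Lemma 4.7). -/
noncomputable def a2 : MvPolynomial (Fin 4) ℤ := 2 * X 1 * X 2 - 2 * X 2 * X 0 - 8 * X 3

/-- `β₁ = 3λ₁ − 2δ₁` (Lemma 4.7). -/
noncomputable def b1 : MvPolynomial (Fin 4) ℤ := 3 * X 2 - 2 * X 1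

/-- `β₂ = 2λ₁² − 3δ₁λ₁ + δ₁² + λ₁γ + γ² + λ₂` (Lemma 4.7). -/
noncomputable def b2 : MvPolynomial (Fin 4) ℤ :=
  2 * X 2 ^ 2 - 3 * X 1 * X 2 + X 1 ^ 2 + X 2 * X 0 + X 0 ^ 2 + X 3

/-- Every `S`-linear combination of the seven generators lies in `IB`. -/
lemma generator_combination_mem_IB (c₀ c₁ c₂ c₃ c₄ c₅ c₆ : MvPolynomial (Fin 4) ℤ) :
    c₀ * (2 * X 0) + c₁ * (X 0 ^ 2 + X 2 * X 0)
      + c₂ * (X 1 ^ 2 + X 1 * X 0 + 8 * X 2 ^ 2 - 12 * X 3)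
      + c₃ * (24 * X 2 ^ 2 - 48 * X 3) + c₄ * (2 * X 1 ^ 2 + 2 * X 2 * X 1)
      + c₅ * (20 * X 2 * X 3 - 4 * X 1 * X 3)
      + c₆ * (8 * X 2 ^ 3 - 8 * X 2 * X 3) ∈ IB := by
  have hmem {p : MvPolynomial (Fin 4) ℤ} (hp : p ∈ ({2 * X 0,
      X 0 ^ 2 + X 2 * X 0,
      X 1 ^ 2 + X 1 * X 0 + 8 * X 2 ^ 2 - 12 * X 3,
      24 * X 2 ^ 2 - 48 * X 3,
      2 * X 1 ^ 2 + 2 * X 2 * X 1,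
      20 * X 2 * X 3 - 4 * X 1 * X 3,
      8 * X 2 ^ 3 - 8 * X 2 * X 3} : Set (MvPolynomial (Fin 4) ℤ)))
      (c : MvPolynomial (Fin 4) ℤ) : c * p ∈ IB :=
    IB.mul_mem_left c (Ideal.subset_span hp)
  refine add_mem (add_mem (add_mem (add_mem (add_mem (add_mem ?_ ?_) ?_) ?_) ?_) ?_) ?_ <;>
    exact hmem (by simp) _

/-- The conclusion of §4.4: of the four norm-pushforward relations excising
`π⁻¹(Δ₀₀₀)` from `B`, the first equals `−16λ₁² + 20δ₁λ₁` in `CH*(B)` and the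
last three already vanish in `CH*(B)`. -/
theorem stmt_17 :
    (12 * a2 + 4 * a1 ^ 2 + 4 * a1 * (b1 + X 0)
        + 16 * X 2 ^ 2 - 20 * X 1 * X 2 ∈ IB) ∧
    ((6 * a2 + 2 * a1 ^ 2) * (b1 + X 0) + 8 * a1 * b2 ∈ IB) ∧
    (10 * a1 * a2 + 6 * a2 * (b1 + X 0) ∈ IB) ∧
    (5 * a1 * a2 * (b1 + X 0) + 12 * a2 * b2 ∈ IB) := by
  refine ⟨?_, ?_, ?_, ?_⟩
  · convert generator_combination_mem_IB
      (-18 * X 2 + 12 * X 1 + 4 * X 0) 0 (-20) 7 8 0 0 using 1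
    simp only [a1, a2, b1]
    ring
  · convert generator_combination_mem_IB
      (-8 * X 3 - 16 * X 2 ^ 2 + 16 * X 1 * X 2 - 17 * X 1 ^ 2 - 5 * X 0 * X 2
        + 3 * X 0 * X 1 + 5 * X 0 ^ 2)
      (-12 * X 2 + 12 * X 1)
      (-4 * X 2 + 46 * X 1 - 10 * X 0)
      (X 2 - 13 * X 1 + 3 * X 0)
      (2 * X 2 - 21 * X 1) (-8) 0 using 1
    simp only [a1, a2, b1, b2]
    ring
  · convert generator_combination_mem_IB
      (-4 * X 3 - 16 * X 2 ^ 2 + 16 * X 1 * X 2 - 10 * X 0 * X 2)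
      (-12 * X 2 + 6 * X 1)
      (-6 * X 2 + 2 * X 1 - 6 * X 0)
      (2 * X 2 - X 1 + 4 * X 0)
      (2 * X 2 - X 1 + 2 * X 0) 2 0 using 1
    simp only [a1, a2, b1]
    ring
  · convert generator_combination_mem_IB
      (8 * X 1 * X 3 + 6 * X 1 * X 2 ^ 2 - 2 * X 1 ^ 2 * X 2 - 8 * X 0 * X 3
        - 24 * X 0 * X 2 ^ 2 + 10 * X 0 * X 1 * X 2 - 10 * X 0 ^ 2 * X 2 + 4 * X 0 ^ 2 * X 1)
      (-4 * X 2 ^ 2 + 8 * X 1 * X 2 - 4 * X 1 ^ 2 - 14 * X 0 * X 2 + 6 * X 0 * X 1)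
      (2 * X 1 * X 2 + 8 * X 0 * X 1 - 14 * X 0 ^ 2)
      (2 * X 3 - X 1 * X 2 + X 0 * X 2 - 2 * X 0 * X 1 + 6 * X 0 ^ 2)
      (-6 * X 3 - 2 * X 2 ^ 2 + X 1 * X 2 - 4 * X 0 * X 1 + 5 * X 0 ^ 2)
      (X 1 - 6 * X 0)
      (-X 0) using 1
    simp only [a1, a2, b1, b2]
    ring
end

section
/- In S, set α₁ := −2λ₁ + δ₁ + γ, α₂ := 2δ₁λ₁ − 2λ₁γ − 8λ₂, β₁ := 3λ₁ − 2δ₁, β₂ := 2λ₁² − 3δ₁λ₁ + δ₁² + λ₁γ + γ² + λ₂. Then: (i) 3α₂ ∈ I_B (equivalently, 6δ₁λ₁ − 6λ₁γ − 24λ₂ ∈ I_B); and (ii) 3α₂ + 24β₂ + 16α₁² + 20α₁β₁ ∈ I_B + (4λ₁ − 2δ₁). (These are the claims of §4.5 and §4.6 that the excision of the double-root locus yields only the relation 4λ₁ − 2δ₁, and that the locus where both linear forms divide the cubic yields no new relation.) -/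
open MvPolynomial

theorem two_mul_gamma_mem_IB : 2 * X 0 ∈ IB :=
  Ideal.subset_span (by simp)

theorem two_mul_delta_sq_add_mem_IB : 2 * X 1 ^ 2 + 2 * X 2 * X 1 ∈ IB :=
  Ideal.subset_span (by simp)

theorem six_mul_delta_mul_lambda_sub_mem_IB :
    6 * X 1 * X 2 - 6 * X 2 * X 0 - 24 * X 3 ∈ IB := by
  have hδ : X 1 ^ 2 + X 1 * X 0 + 8 * X 2 ^ 2 - 12 * X 3 ∈ IB :=
    Ideal.subset_span (by simp)
  have hl : 24 * X 2 ^ 2 - 48 * X 3 ∈ IB := Ideal.subset_span (by simp)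
  have h := IB.add_mem
    (IB.add_mem (IB.mul_mem_left 3 two_mul_delta_sq_add_mem_IB) (IB.mul_mem_left (-6) hδ))
    (IB.add_mem (IB.mul_mem_left 2 hl)
      (IB.mul_mem_left (3 * X 1 - 3 * X 2) two_mul_gamma_mem_IB))
  convert h using 1
  ring

/-- The claims of §4.5 and §4.6: `3α₂ ∈ I_B` (equivalently
`6δ₁λ₁ − 6λ₁γ − 24λ₂ ∈ I_B`), and `3α₂ + 24β₂ + 16α₁² + 20α₁β₁` lies in
`I_B + (4λ₁ − 2δ₁)`, so the double-root excision yields only the relation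
`4λ₁ − 2δ₁` and the second locus yields no new relation. -/
theorem stmt_18 :
    (3 * a2 ∈ IB) ∧
    (6 * X 1 * X 2 - 6 * X 2 * X 0 - 24 * X 3 ∈ IB) ∧
    (3 * a2 + 24 * b2 + 16 * a1 ^ 2 + 20 * a1 * b1 ∈
      IB ⊔ Ideal.span ({4 * X 2 - 2 * X 1} : Set (MvPolynomial (Fin 4) ℤ))) := by
  refine ⟨?_, six_mul_delta_mul_lambda_sub_mem_IB, ?_⟩
  · convert six_mul_delta_mul_lambda_sub_mem_IB using 1
    rw [a2]
    ring
  · have h := Submodule.add_mem_sup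
      (IB.add_mem two_mul_delta_sq_add_mem_IB
        (IB.mul_mem_left (7 * X 2 + 20 * X 0 - 4 * X 1) two_mul_gamma_mem_IB))
      (Ideal.mul_mem_left _ (X 1 - 2 * X 2)
        (Ideal.mem_span_singleton_self (4 * X 2 - 2 * X 1 : MvPolynomial (Fin 4) ℤ)))
    convert h using 1
    rw [a1, a2, b1, b2]
    ring
end

section
/- In R, the polynomial 48λ₂²δ₁ lies in the ideal J; that is, 48λ₂²δ₁ = 0 in the integral Chow ring CH*(M̄₂) = R/J. (This torsion relation is used in §5.1 to reduce the undetermined coefficient of β₃₂ to an element of {0,1}.) -/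
open MvPolynomial

/-- The torsion relation `48λ₂²δ₁ = 0` in `CH*(M̄₂)`, used in §5.1. -/
theorem stmt_19 :
    (48 * X 1 ^ 2 * X 2 : MvPolynomial (Fin 3) ℤ) ∈ Jm2 := by
  have h₁ : (24 * X 0 ^ 2 - 48 * X 1 : MvPolynomial (Fin 3) ℤ) ∈ Jm2 :=
    Ideal.subset_span (by simp)
  have h₂ : (20 * X 0 * X 1 - 4 * X 2 * X 1 : MvPolynomial (Fin 3) ℤ) ∈ Jm2 :=
    Ideal.subset_span (by simp)
  have h₄ : (2 * X 2 ^ 2 + 2 * X 2 * X 0 : MvPolynomial (Fin 3) ℤ) ∈ Jm2 :=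
    Ideal.subset_span (by simp)
  have key : (48 * X 1 ^ 2 * X 2 : MvPolynomial (Fin 3) ℤ) =
      X 0 * X 2 * (20 * X 0 * X 1 - 4 * X 2 * X 1)
        + 2 * X 0 * X 1 * (2 * X 2 ^ 2 + 2 * X 2 * X 0)
        - X 1 * X 2 * (24 * X 0 ^ 2 - 48 * X 1) := by ring
  rw [key]
  exact Jm2.sub_mem (Jm2.add_mem (Jm2.mul_mem_left _ h₂) (Jm2.mul_mem_left _ h₄))
    (Jm2.mul_mem_left _ h₁)
end
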